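/- arXiv:2505.02386 — 3 statements merged into one kernel-verified Lean document; each statement's English description precedes it below -/
import Mathlib

section
/- For every integer d with |d| ≥ 2g - 1 and every g ≥ 1, there exists a triangulation of the closed orientable genus g surface with 7|d| + 2 - 2g vertices admitting a simplicial map of degree d to the 7-vertex triangulation of the torus, and no triangulation with fewer vertices admits such a map. -/
/-!
A combinatorial model of (coherently oriented) triangulations of closed
orientable surfaces.  A triangulation is recorded by its set `F` of *oriented*
facets: ordered triples of distinct vertices, closed under cyclic rotation,
such that every directed edge lies in exactly one oriented facet (this is
exactly a coherent orientation of a closed triangulated surface), with no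
isolated vertices, connected, and with connected vertex links (so the
underlying polyhedron is a closed surface).
-/
structure OSurf (V : Type) [DecidableEq V] [Fintype V] : Type where
  F : Finset (V × V × V)
  rot_mem : ∀ a b c, (a, b, c) ∈ F → (b, c, a) ∈ F
  nondegen : ∀ a b c, (a, b, c) ∈ F → a ≠ b ∧ b ≠ c ∧ a ≠ c
  dart_unique : ∀ a b c c', (a, b, c) ∈ F → (a, b, c') ∈ F → c = c'
  dart_rev : ∀ a b c, (a, b, c) ∈ F → ∃ c', (b, a, c') ∈ F
  vertex_cover : ∀ v : V, ∃ b c, (v, b, c) ∈ F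
  connected : ∀ x ∈ F, ∀ y ∈ F,
    Relation.ReflTransGen (fun s t : V × V × V => s ∈ F ∧ t ∈ F ∧
      2 ≤ (({s.1, s.2.1, s.2.2} : Finset V) ∩ {t.1, t.2.1, t.2.2}).card) x y
  link_connected : ∀ v : V, ∀ x ∈ F, ∀ y ∈ F,
    v ∈ ({x.1, x.2.1, x.2.2} : Finset V) → v ∈ ({y.1, y.2.1, y.2.2} : Finset V) →
    Relation.ReflTransGen (fun s t : V × V × V => s ∈ F ∧ t ∈ F ∧
      v ∈ ({s.1, s.2.1, s.2.2} : Finset V) ∧ v ∈ ({t.1, t.2.1, t.2.2} : Finset V) ∧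
      2 ≤ (({s.1, s.2.1, s.2.2} : Finset V) ∩ {t.1, t.2.1, t.2.2}).card) x y

variable {V W : Type} [DecidableEq V] [Fintype V] [DecidableEq W] [Fintype W]

/-- The (unoriented) triangles of the triangulation. -/
def OSurf.faces (K : OSurf V) : Finset (Finset V) :=
  K.F.image fun x => {x.1, x.2.1, x.2.2}

/-- The edges of the triangulation. -/
def OSurf.edges (K : OSurf V) : Finset (Finset V) :=
  K.faces.biUnion fun t => Finset.powersetCard 2 t

/-- `K` triangulates the closed orientable surface of genus `g`, recorded via the
Euler characteristic `n - e + f = 2 - 2g`. -/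
def OSurf.genusIs (K : OSurf V) (g : ℕ) : Prop :=
  (Fintype.card V : ℤ) - K.edges.card + K.faces.card = 2 - 2 * g

/-- `φ` is a simplicial map from `K` to `L`: the image of every face of `K` is a
face of `L` (possibly of lower dimension). -/
def IsSimplicialMap (K : OSurf V) (L : OSurf W) (φ : V → W) : Prop :=
  ∀ x ∈ K.F, ∃ t ∈ L.faces, ({φ x.1, φ x.2.1, φ x.2.2} : Finset W) ⊆ t

/-- `φ : K → L` has degree `d`: for every oriented facet `σ` of `L`, the number of
facets of `K` mapped onto `σ` preserving orientation minus the number mapped onto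
`σ` reversing orientation equals `d` (the algebraic count `alg σ`, which computes
the homological degree `f₂([K]) = d·[L]`). -/
def HasDegree (K : OSurf V) (L : OSurf W) (φ : V → W) (d : ℤ) : Prop :=
  ∀ p q r, (p, q, r) ∈ L.F →
    ((K.F.filter fun x => (φ x.1, φ x.2.1, φ x.2.2) = (p, q, r)).card : ℤ) -
      ((K.F.filter fun x => (φ x.1, φ x.2.1, φ x.2.2) = (p, r, q)).card : ℤ) = d

/-- The coherently oriented facets of the unique `7`-vertex triangulation of the
torus (vertices `1,…,7`, where `7 = 0` in `Fin 7`): the `14` facets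
`124, 245, 235, 356, 156, 126, 267, 237, 137, 157, 457, 467, 346, 134`,
each taken with its coherent orientation (with `[1,2,4]` positively oriented),
closed under cyclic rotation. -/
def torusPos : Finset (Fin 7 × Fin 7 × Fin 7) :=
  {(1,2,4), (2,3,5), (3,4,6), (4,5,7), (5,6,1), (6,7,2), (7,1,3),
   (1,4,3), (2,5,4), (3,6,5), (4,7,6), (5,1,7), (6,2,1), (7,3,2)}

def torusF : Finset (Fin 7 × Fin 7 × Fin 7) :=
  torusPos ∪ torusPos.image (fun x => (x.2.1, x.2.2, x.1)) ∪
    torusPos.image (fun x => (x.2.2, x.1, x.2.1))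


set_option linter.unusedSectionVars false

section Counting

/-- Rotating the corners of an oriented facet gives three different oriented facets. -/
lemma three_faces_le (K : OSurf V) : 3 * K.faces.card ≤ K.F.card := by
  unfold OSurf.faces
  rw [mul_comm]
  have := Finset.mul_card_image_le_card (s := K.F)
    (f := fun x : V × V × V => ({x.1, x.2.1, x.2.2} : Finset V)) (n := 3) ?_
  · rw [mul_comm]; exact this
  intro t ht
  obtain ⟨⟨a, b, c⟩, hx, rfl⟩ := Finset.mem_image.1 ht
  obtain ⟨hab, hbc, hac⟩ := K.nondegen _ _ _ hx
  have h2 := K.rot_mem _ _ _ hx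
  have h3 := K.rot_mem _ _ _ h2
  have : ({(a, b, c), (b, c, a), (c, a, b)} : Finset (V × V × V)).card = 3 := by
    rw [Finset.card_eq_three]
    refine ⟨_, _, _, ?_, ?_, ?_, rfl⟩ <;> simp [hab, hac, hbc, hab.symm, hac.symm, hbc.symm]
  rw [← this]
  apply Finset.card_le_card
  intro y hy
  simp only [Finset.mem_insert, Finset.mem_singleton] at hy
  rw [Finset.mem_filter]
  rcases hy with rfl | rfl | rfl
  · exact ⟨hx, rfl⟩
  · refine ⟨h2, ?_⟩; ext; simp; tauto
  · refine ⟨h3, ?_⟩; ext; simp; tauto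

/-- If no triangle occurs with both orientations, each triangle has exactly three lifts. -/
lemma three_faces_eq (K : OSurf V) (hK : ∀ a b c, (a, b, c) ∈ K.F → (b, a, c) ∉ K.F) :
    3 * K.faces.card = K.F.card := by
  apply le_antisymm (three_faces_le K)
  unfold OSurf.faces
  refine Finset.card_le_mul_card_image (s := K.F)
    (f := fun x : V × V × V => ({x.1, x.2.1, x.2.2} : Finset V)) 3 ?_
  intro t ht
  obtain ⟨⟨a, b, c⟩, hx, rfl⟩ := Finset.mem_image.1 ht
  obtain ⟨hab, hbc, hac⟩ := K.nondegen _ _ _ hx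
  have h2 := K.rot_mem _ _ _ hx
  have h3 := K.rot_mem _ _ _ h2
  have n1 := hK _ _ _ hx
  have n2 := hK _ _ _ h2
  have n3 := hK _ _ _ h3
  refine le_trans (Finset.card_le_card (t := {(a, b, c), (b, c, a), (c, a, b)}) ?_)
    Finset.card_le_three
  rintro ⟨u, v, w⟩ hy
  rw [Finset.mem_filter] at hy
  obtain ⟨hy, he⟩ := hy
  obtain ⟨huv, hvw, huw⟩ := K.nondegen _ _ _ hy
  have e1 : u = a ∨ u = b ∨ u = c := by
    have : u ∈ ({u, v, w} : Finset V) := by simp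
    rw [he] at this; simpa using this
  have e2 : v = a ∨ v = b ∨ v = c := by
    have : v ∈ ({u, v, w} : Finset V) := by simp
    rw [he] at this; simpa using this
  have e3 : w = a ∨ w = b ∨ w = c := by
    have : w ∈ ({u, v, w} : Finset V) := by simp
    rw [he] at this; simpa using this
  simp only [Finset.mem_insert, Finset.mem_singleton]
  rcases e1 with rfl | rfl | rfl <;> rcases e2 with rfl | rfl | rfl <;>
    rcases e3 with rfl | rfl | rfl <;>
    first
      | exact absurd rfl huv
      | exact absurd rfl hvw
      | exact absurd rfl huw
      | exact absurd hy n1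
      | exact absurd hy n2
      | exact absurd hy n3
      | simp

lemma edges_eq_image (K : OSurf V) :
    K.edges = K.F.image fun x => ({x.1, x.2.1} : Finset V) := by
  ext s
  simp only [OSurf.edges, OSurf.faces, Finset.mem_biUnion, Finset.mem_image,
    Finset.mem_powersetCard]
  constructor
  · rintro ⟨t, ⟨⟨a, b, c⟩, hx, rfl⟩, hs, hc⟩
    obtain ⟨hab, hbc, hac⟩ := K.nondegen _ _ _ hx
    have h2 := K.rot_mem _ _ _ hx
    have h3 := K.rot_mem _ _ _ h2
    obtain ⟨u, v, huv, rfl⟩ := Finset.card_eq_two.1 hc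
    have e1 : u = a ∨ u = b ∨ u = c := by
      simpa using hs (show u ∈ ({u, v} : Finset V) by simp)
    have e2 : v = a ∨ v = b ∨ v = c := by
      simpa using hs (show v ∈ ({u, v} : Finset V) by simp)
    rcases e1 with rfl | rfl | rfl <;> rcases e2 with rfl | rfl | rfl <;>
      first
        | exact absurd rfl huv
        | exact ⟨_, hx, rfl⟩
        | exact ⟨_, h2, rfl⟩
        | exact ⟨_, h3, rfl⟩
        | exact ⟨_, hx, Finset.pair_comm _ _⟩
        | exact ⟨_, h2, Finset.pair_comm _ _⟩
        | exact ⟨_, h3, Finset.pair_comm _ _⟩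
  · rintro ⟨⟨a, b, c⟩, hx, rfl⟩
    obtain ⟨hab, hbc, hac⟩ := K.nondegen _ _ _ hx
    refine ⟨_, ⟨_, hx, rfl⟩, ?_, Finset.card_pair hab⟩
    intro y; simp; tauto

/-- Each edge carries two darts, each in exactly one oriented facet. -/
lemma two_edges_eq (K : OSurf V) : 2 * K.edges.card = K.F.card := by
  rw [edges_eq_image]
  have key : ∀ t ∈ K.F.image (fun x : V × V × V => ({x.1, x.2.1} : Finset V)),
      (K.F.filter fun x => ({x.1, x.2.1} : Finset V) = t).card = 2 := by
    intro t ht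
    obtain ⟨⟨a, b, c⟩, hx, rfl⟩ := Finset.mem_image.1 ht
    obtain ⟨hab, hbc, hac⟩ := K.nondegen _ _ _ hx
    obtain ⟨c', hc'⟩ := K.dart_rev _ _ _ hx
    rw [Finset.card_eq_two]
    refine ⟨(a, b, c), (b, a, c'), by simp [hab], ?_⟩
    ext ⟨u, v, w⟩
    simp only [Finset.mem_filter, Finset.mem_insert, Finset.mem_singleton]
    constructor
    · rintro ⟨hy, he⟩
      obtain ⟨huv, -, -⟩ := K.nondegen _ _ _ hy
      have e1 : u = a ∨ u = b := by
        have : u ∈ ({u, v} : Finset V) := by simp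
        rw [he] at this; simpa using this
      have e2 : v = a ∨ v = b := by
        have : v ∈ ({u, v} : Finset V) := by simp
        rw [he] at this; simpa using this
      rcases e1 with rfl | rfl <;> rcases e2 with rfl | rfl
      · exact absurd rfl huv
      · left; rw [K.dart_unique _ _ _ _ hx hy]
      · right; rw [K.dart_unique _ _ _ _ hc' hy]
      · exact absurd rfl huv
    · rintro (h | h)
      · obtain ⟨rfl, rfl, rfl⟩ : u = a ∧ v = b ∧ w = c := by simpa using h
        exact ⟨hx, rfl⟩
      · obtain ⟨rfl, rfl, rfl⟩ : u = b ∧ v = a ∧ w = c' := by simpa using h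
        exact ⟨hc', Finset.pair_comm _ _⟩
  have := Finset.card_eq_sum_card_image (fun x : V × V × V => ({x.1, x.2.1} : Finset V)) K.F
  rw [this, Finset.sum_congr rfl key]
  simp [mul_comm]

lemma torusF_card : torusF.card = 42 := by decide

set_option maxRecDepth 20000 in
lemma torusF_rev : ∀ x ∈ torusF, (x.2.1, x.1, x.2.2) ∉ torusF := by decide

set_option maxRecDepth 20000 in
lemma torusF_rev' : ∀ x ∈ torusF, (x.1, x.2.2, x.2.1) ∉ torusF := by decide

lemma card_F_ge (T : OSurf (Fin 7)) (hT : T.F = torusF) (K : OSurf V) (φ : V → Fin 7) (d : ℤ)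
    (h : HasDegree K T φ d) : 42 * |d| ≤ (K.F.card : ℤ) := by
  rw [HasDegree, hT] at h
  have a1 : ∑ t ∈ torusF, (K.F.filter fun x => (φ x.1, φ x.2.1, φ x.2.2) = t).card
      ≤ K.F.card := by
    rw [← Finset.card_biUnion]
    · apply Finset.card_le_card
      intro y; simp
    · intro s _ t _ hst
      simp only [Finset.disjoint_left, Finset.mem_filter]
      rintro y ⟨_, rfl⟩ ⟨_, h⟩
      exact hst h
  have a2 : ∑ t ∈ torusF, (K.F.filter fun x => (φ x.1, φ x.2.1, φ x.2.2) =
      (t.1, t.2.2, t.2.1)).card ≤ K.F.card := by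
    rw [← Finset.card_biUnion]
    · apply Finset.card_le_card
      intro y; simp
    · rintro ⟨s1, s2, s3⟩ _ ⟨t1, t2, t3⟩ _ hst
      simp only [Finset.disjoint_left, Finset.mem_filter]
      rintro y ⟨_, h1⟩ ⟨_, h2⟩
      apply hst
      rw [h1] at h2
      simp only [Prod.mk.injEq] at h2 ⊢
      exact ⟨h2.1, h2.2.2, h2.2.1⟩
  have b1 : ∑ t ∈ torusF, d ≤
      ∑ t ∈ torusF, ((K.F.filter fun x => (φ x.1, φ x.2.1, φ x.2.2) = t).card : ℤ) := by
    apply Finset.sum_le_sum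
    intro t ht
    have := h t.1 t.2.1 t.2.2 ht
    linarith [Int.natCast_nonneg (K.F.filter fun x => (φ x.1, φ x.2.1, φ x.2.2) =
        (t.1, t.2.2, t.2.1)).card]
  have b2 : ∑ t ∈ torusF, (-d) ≤
      ∑ t ∈ torusF, ((K.F.filter fun x => (φ x.1, φ x.2.1, φ x.2.2) =
        (t.1, t.2.2, t.2.1)).card : ℤ) := by
    apply Finset.sum_le_sum
    intro t ht
    have := h t.1 t.2.1 t.2.2 ht
    linarith [Int.natCast_nonneg (K.F.filter fun x => (φ x.1, φ x.2.1, φ x.2.2) =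
        (t.1, t.2.1, t.2.2)).card]
  rw [Finset.sum_const, torusF_card] at b1 b2
  have a1' := Int.ofNat_le.2 a1
  have a2' := Int.ofNat_le.2 a2
  push_cast at a1' a2'
  rcases abs_cases d with ⟨e, _⟩ | ⟨e, _⟩ <;> rw [e] <;>
    simp only [nsmul_eq_mul, Nat.cast_ofNat] at b1 b2 <;> linarith

lemma lower_bound (g : ℕ) (T : OSurf (Fin 7)) (hT : T.F = torusF) (K : OSurf V) (φ : V → Fin 7)
    (d : ℤ) (hg : K.genusIs g) (h : HasDegree K T φ d) :
    7 * |d| + 2 - 2 * (g : ℤ) ≤ (Fintype.card V : ℤ) := by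
  have h1 := card_F_ge T hT K φ d h
  have h2 := two_edges_eq K
  have h3 := three_faces_le K
  unfold OSurf.genusIs at hg
  generalize |d| = D at *
  omega

end Counting

section Reverse

/-- Reversal of the orientation of a triple. -/
def swp {V : Type} (x : V × V × V) : V × V × V := (x.2.1, x.1, x.2.2)

lemma mem_swp {F : Finset (V × V × V)} {a b c : V} :
    (a, b, c) ∈ F.image swp ↔ (b, a, c) ∈ F := by
  simp only [Finset.mem_image, swp, Prod.mk.injEq]
  constructor
  · rintro ⟨⟨u, v, w⟩, h, rfl, rfl, rfl⟩; exact h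
  · intro h; exact ⟨_, h, rfl, rfl, rfl⟩

lemma set_swp (x : V × V × V) :
    ({(swp x).1, (swp x).2.1, (swp x).2.2} : Finset V) = {x.1, x.2.1, x.2.2} := by
  ext; simp [swp]; tauto

/-- The same triangulated surface with the opposite orientation. -/
def OSurf.rev (K : OSurf V) : OSurf V where
  F := K.F.image swp
  rot_mem := by
    intro a b c h
    rw [mem_swp] at h ⊢
    exact K.rot_mem _ _ _ (K.rot_mem _ _ _ h)
  nondegen := by
    intro a b c h
    rw [mem_swp] at h
    obtain ⟨h1, h2, h3⟩ := K.nondegen _ _ _ h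
    exact ⟨h1.symm, h3, h2⟩
  dart_unique := by
    intro a b c c' h h'
    rw [mem_swp] at h h'
    exact K.dart_unique _ _ _ _ h h'
  dart_rev := by
    intro a b c h
    rw [mem_swp] at h
    obtain ⟨c', h'⟩ := K.dart_rev _ _ _ h
    exact ⟨c', mem_swp.2 h'⟩
  vertex_cover := by
    intro v
    obtain ⟨b, c, h⟩ := K.vertex_cover v
    exact ⟨c, b, mem_swp.2 (K.rot_mem _ _ _ (K.rot_mem _ _ _ h))⟩
  connected := by
    intro x hx y hy
    obtain ⟨x, hx', rfl⟩ := Finset.mem_image.1 hx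
    obtain ⟨y, hy', rfl⟩ := Finset.mem_image.1 hy
    refine Relation.ReflTransGen.lift swp ?_ _ _ (K.connected x hx' y hy')
    rintro s t ⟨hs, ht, h⟩
    refine ⟨Finset.mem_image_of_mem _ hs, Finset.mem_image_of_mem _ ht, ?_⟩
    rw [set_swp, set_swp]
    exact h
  link_connected := by
    intro v x hx y hy hvx hvy
    obtain ⟨x, hx', rfl⟩ := Finset.mem_image.1 hx
    obtain ⟨y, hy', rfl⟩ := Finset.mem_image.1 hy
    rw [set_swp] at hvx hvy
    refine Relation.ReflTransGen.lift swp ?_ _ _ (K.link_connected v x hx' y hy' hvx hvy)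
    rintro s t ⟨hs, ht, hvs, hvt, h⟩
    refine ⟨Finset.mem_image_of_mem _ hs, Finset.mem_image_of_mem _ ht, ?_⟩
    rw [set_swp, set_swp]
    exact ⟨hvs, hvt, h⟩

lemma rev_faces (K : OSurf V) : K.rev.faces = K.faces := by
  unfold OSurf.faces
  change (K.F.image swp).image _ = _
  rw [Finset.image_image]
  apply Finset.image_congr
  intro x _
  exact set_swp x

lemma rev_genus (K : OSurf V) (g : ℕ) (h : K.genusIs g) : K.rev.genusIs g := by
  unfold OSurf.genusIs OSurf.edges at *
  rwa [rev_faces]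

lemma rev_simplicial (K : OSurf V) (L : OSurf W) (φ : V → W) (h : IsSimplicialMap K L φ) :
    IsSimplicialMap K.rev L φ := by
  intro x hx
  obtain ⟨x, hx', rfl⟩ := Finset.mem_image.1 hx
  obtain ⟨t, ht, hs⟩ := h x hx'
  refine ⟨t, ht, subset_trans (le_of_eq ?_) hs⟩
  exact set_swp (φ x.1, φ x.2.1, φ x.2.2)

lemma count_rot (K : OSurf V) (φ : V → W) (p q r : W) :
    (K.F.filter fun x => (φ x.1, φ x.2.1, φ x.2.2) = (p, q, r)).card =
      (K.F.filter fun x => (φ x.1, φ x.2.1, φ x.2.2) = (q, r, p)).card := by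
  apply Finset.card_bij (fun x _ => (x.2.1, x.2.2, x.1))
  · rintro ⟨a, b, c⟩ hx
    rw [Finset.mem_filter] at hx ⊢
    refine ⟨K.rot_mem _ _ _ hx.1, ?_⟩
    have := hx.2
    simp only [Prod.mk.injEq] at this ⊢
    tauto
  · rintro ⟨a, b, c⟩ _ ⟨a', b', c'⟩ _ hxy
    simp only [Prod.mk.injEq] at hxy ⊢
    tauto
  · rintro ⟨a, b, c⟩ hx
    rw [Finset.mem_filter] at hx
    refine ⟨(c, a, b), ?_, rfl⟩
    rw [Finset.mem_filter]
    refine ⟨K.rot_mem _ _ _ (K.rot_mem _ _ _ hx.1), ?_⟩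
    have := hx.2
    simp only [Prod.mk.injEq] at this ⊢
    tauto

lemma rev_degree (K : OSurf V) (L : OSurf W) (φ : V → W) (d : ℤ) (h : HasDegree K L φ d) :
    HasDegree K.rev L φ (-d) := by
  have key : ∀ p q r : W, ((K.F.image swp).filter fun x =>
      (φ x.1, φ x.2.1, φ x.2.2) = (p, q, r)).card =
      (K.F.filter fun x => (φ x.1, φ x.2.1, φ x.2.2) = (q, p, r)).card := by
    intro p q r
    symm
    apply Finset.card_bij (fun x _ => swp x)
    · intro x hx
      rw [Finset.mem_filter] at hx ⊢
      refine ⟨Finset.mem_image_of_mem _ hx.1, ?_⟩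
      have := hx.2
      simp only [Prod.mk.injEq, swp] at this ⊢
      tauto
    · intro x _ y _ hxy
      have := congrArg swp hxy
      exact this
    · intro y hy
      rw [Finset.mem_filter] at hy
      obtain ⟨hy, he⟩ := hy
      obtain ⟨x, hx, rfl⟩ := Finset.mem_image.1 hy
      refine ⟨x, ?_, rfl⟩
      rw [Finset.mem_filter]
      refine ⟨hx, ?_⟩
      simp only [Prod.mk.injEq, swp] at he ⊢
      tauto
  intro p q r hpqr
  have h1 := h p q r hpqr
  have e1 := key p q r
  have e2 := key p r q
  have e3 := count_rot K φ p r q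
  have e4 := count_rot K φ r q p
  have e5 := count_rot K φ r p q
  have e6 := count_rot K φ q p r
  change (((K.F.image swp).filter _).card : ℤ) - (((K.F.image swp).filter _).card : ℤ) = -d
  rw [e1, e2, e5, ← h1, e6]
  ring

end Reverse
section Cover

/-- Voltages of the directed edges of the torus (away from the vertex `0`). -/
def volt {G : Type} [Group G] (x z : G) : Fin 7 → Fin 7 → G :=
  ![![1, 1, 1, 1, 1, 1, 1],
    ![1, 1, x, 1, z * x, z * x⁻¹ * z⁻¹ * x, x],
    ![1, x⁻¹, 1, 1, z, z, 1],
    ![1, 1, 1, 1, z * x, z, z * x],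
    ![1, x⁻¹ * z⁻¹, z⁻¹, x⁻¹ * z⁻¹, 1, 1, 1],
    ![1, x⁻¹ * z * x * z⁻¹, z⁻¹, z⁻¹, 1, 1, z * x * z⁻¹],
    ![1, x⁻¹, 1, x⁻¹ * z⁻¹, 1, z * x⁻¹ * z⁻¹, 1]]

lemma volt_inv {G : Type} [Group G] (x z : G) (p q : Fin 7) :
    volt x z q p = (volt x z p q)⁻¹ := by
  fin_cases p <;> fin_cases q <;> simp [volt, mul_assoc]

set_option maxRecDepth 20000 in
lemma torusF_zero : ∀ q r : Fin 7, (0, q, r) ∈ torusF →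
    (q = 1 ∧ r = 3) ∨ (q = 3 ∧ r = 2) ∨ (q = 2 ∧ r = 6) ∨ (q = 6 ∧ r = 4) ∨ (q = 4 ∧ r = 5) ∨
    (q = 5 ∧ r = 1) := by decide

set_option maxRecDepth 20000 in
lemma torusF_list : ∀ t ∈ torusF, t.1 ≠ 0 → t.2.1 ≠ 0 → t.2.2 ≠ 0 →
    t ∈ [((1, 2, 4) : Fin 7 × Fin 7 × Fin 7), (2, 3, 5), (3, 4, 6), (5, 6, 1),
      (1, 4, 3), (2, 5, 4), (3, 6, 5), (6, 2, 1),
      (2, 4, 1), (3, 5, 2), (4, 6, 3), (6, 1, 5),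
      (4, 3, 1), (5, 4, 2), (6, 5, 3), (2, 1, 6),
      (4, 1, 2), (5, 2, 3), (6, 3, 4), (1, 5, 6),
      (3, 1, 4), (4, 2, 5), (5, 3, 6), (1, 6, 2)] := by decide

lemma volt_cocycle {G : Type} [Group G] (x z : G) (p q r : Fin 7) (h : (p, q, r) ∈ torusF)
    (hp : p ≠ 0) (hq : q ≠ 0) (hr : r ≠ 0) : volt x z q r * volt x z p q = volt x z p r := by
  have := torusF_list _ h hp hq hr
  clear h hp hq hr
  simp only [List.mem_cons, Prod.mk.injEq, List.not_mem_nil, or_false] at this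
  casesm* _ ∨ _ <;> obtain ⟨rfl, rfl, rfl⟩ := this <;> simp [volt, mul_assoc]

set_option maxRecDepth 20000 in
lemma torusF_rot : ∀ t ∈ torusF, (t.2.1, t.2.2, t.1) ∈ torusF := by decide

set_option maxRecDepth 20000 in
lemma torusF_nd : ∀ t ∈ torusF, t.1 ≠ t.2.1 ∧ t.2.1 ≠ t.2.2 ∧ t.1 ≠ t.2.2 := by decide

/-- Data describing a branched cover of the torus, branched over the vertex `0`. -/
structure Cov (S V : Type) where
  x : Equiv.Perm S
  z : Equiv.Perm S
  pr : V → Fin 7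
  sh : V → S
  enc : Fin 7 → S → V
  pr_enc : ∀ p i, pr (enc p i) = p
  sh_enc : ∀ p i, p ≠ 0 → sh (enc p i) = i
  enc_eta : ∀ A, enc (pr A) (sh A) = A
  enc_c : ∀ i, enc 0 ((x⁻¹ * z * x * z⁻¹) i) = enc 0 i
  enc_inj : ∀ i j, enc 0 i = enc 0 j →
    Relation.EqvGen (fun a b => b = (x⁻¹ * z * x * z⁻¹) a) i j
  trans : ∀ i j, Relation.EqvGen (fun a b => b = x a) i j

variable {S : Type} (D : Cov S V)

namespace Cov

/-- `A` and `B` span an edge of the cover. -/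
def adj (A B : V) : Prop :=
  if D.pr A = 0 then A = D.enc 0 (D.sh B) else
    if D.pr B = 0 then B = D.enc 0 (D.sh A) else
      D.sh B = volt D.x D.z (D.pr A) (D.pr B) (D.sh A)

lemma adj_symm {A B : V} (hn : D.pr A ≠ D.pr B) (h : D.adj A B) : D.adj B A := by
  unfold adj at *
  split_ifs at * with h1 h2 h2
  · exact absurd (h2.trans h1.symm) hn
  · exact h
  · exact h
  · rw [h, volt_inv _ _ (D.pr A) (D.pr B)]; simp

lemma adj_det {A B B' : V} (hA : D.pr A ≠ 0) (hB : D.pr B = D.pr B') (h : D.adj A B)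
    (h' : D.adj A B') : B = B' := by
  unfold adj at *
  rw [if_neg hA] at h h'
  rw [← hB] at h'
  split_ifs at * with h1
  · rw [h, h']
  · rw [← D.enc_eta B, ← D.enc_eta B', h, h', hB]

lemma hex {q r : Fin 7} (h : (0, q, r) ∈ torusF) (i : S) :
    D.enc 0 (volt D.x D.z q r i) = D.enc 0 i := by
  rcases torusF_zero q r h with h | h | h | h | h | h <;> obtain ⟨rfl, rfl⟩ := h
  · rfl
  · rfl
  · rfl
  · rfl
  · rfl
  · exact D.enc_c i

lemma hex' {q r : Fin 7} (h : (0, q, r) ∈ torusF) (i : S) :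
    D.enc 0 (volt D.x D.z r q i) = D.enc 0 i := by
  rw [← D.hex h (volt D.x D.z r q i), volt_inv _ _ r q]; simp

lemma extend {A B : V} {r : Fin 7} (h : (D.pr A, D.pr B, r) ∈ torusF) (hAB : D.adj A B) :
    ∃ C, D.pr C = r ∧ D.adj B C ∧ D.adj C A := by
  have hnd := torusF_nd _ h
  simp only at hnd
  obtain ⟨n1, n2, n3⟩ := hnd
  by_cases hA : D.pr A = 0
  · have hB : D.pr B ≠ 0 := fun e => n1 (hA.trans e.symm)
    have hr : r ≠ 0 := fun e => n3 (hA.trans e.symm)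
    refine ⟨D.enc r (volt D.x D.z (D.pr B) r (D.sh B)), D.pr_enc _ _, ?_, ?_⟩
    · simp [adj, hB, D.pr_enc, hr, D.sh_enc]
    · simp only [adj, hA, if_true] at hAB
      rw [hA] at h
      simp only [adj, hA, D.pr_enc, hr, if_true, if_false]
      rw [D.sh_enc _ _ hr, D.hex h]
      exact hAB
  · by_cases hB : D.pr B = 0
    · have hr : r ≠ 0 := fun e => n2 (hB.trans e.symm)
      refine ⟨D.enc r (volt D.x D.z (D.pr A) r (D.sh A)), D.pr_enc _ _, ?_, ?_⟩
      · simp only [adj, hB, hA, if_true, if_false] at hAB ⊢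
        rw [hB] at h
        rw [D.sh_enc _ _ hr, D.hex' (torusF_rot _ h)]
        exact hAB
      · simp only [adj, D.pr_enc, hr, hA, if_false]
        rw [D.sh_enc _ _ hr, volt_inv _ _ (D.pr A) r]; simp
    · simp only [adj, hA, hB, if_false] at hAB
      by_cases hr : r = 0
      · subst hr
        refine ⟨D.enc 0 (D.sh A), D.pr_enc _ _, ?_, ?_⟩
        · simp only [adj, hB, D.pr_enc, if_true, if_false]
          rw [hAB, D.hex (torusF_rot _ (torusF_rot _ h))]
        · simp only [adj, D.pr_enc, if_true]
      · refine ⟨D.enc r (volt D.x D.z (D.pr A) r (D.sh A)), D.pr_enc _ _, ?_, ?_⟩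
        · simp only [adj, hB, D.pr_enc, hr, if_false]
          rw [D.sh_enc _ _ hr, hAB, ← volt_cocycle D.x D.z _ _ _ h hA hB hr]; rfl
        · simp only [adj, D.pr_enc, hr, hA, if_false]
          rw [D.sh_enc _ _ hr, volt_inv _ _ (D.pr A) r]; simp

open Classical in
/-- The oriented facets of the cover. -/
noncomputable def F : Finset (V × V × V) :=
  Finset.univ.filter fun t => (D.pr t.1, D.pr t.2.1, D.pr t.2.2) ∈ torusF ∧
    D.adj t.1 t.2.1 ∧ D.adj t.2.1 t.2.2 ∧ D.adj t.2.2 t.1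

lemma mem_F {A B C : V} : (A, B, C) ∈ D.F ↔ (D.pr A, D.pr B, D.pr C) ∈ torusF ∧
    D.adj A B ∧ D.adj B C ∧ D.adj C A := by
  simp [F]

lemma F_rot {A B C : V} (h : (A, B, C) ∈ D.F) : (B, C, A) ∈ D.F := by
  rw [mem_F] at *
  exact ⟨torusF_rot _ h.1, h.2.2.1, h.2.2.2, h.2.1⟩

lemma F_nd {A B C : V} (h : (A, B, C) ∈ D.F) :
    D.pr A ≠ D.pr B ∧ D.pr B ≠ D.pr C ∧ D.pr A ≠ D.pr C := by
  rw [mem_F] at h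
  exact torusF_nd _ h.1

lemma F_unique {A B C C' : V} (h : (A, B, C) ∈ D.F) (h' : (A, B, C') ∈ D.F)
    (hC : D.pr C = D.pr C') : C = C' := by
  have n := D.F_nd h
  have n' := D.F_nd h'
  rw [mem_F] at h h'
  by_cases hA : D.pr A = 0
  · have hB : D.pr B ≠ 0 := fun e => n.1 (hA.trans e.symm)
    exact D.adj_det hB hC h.2.2.1 h'.2.2.1
  · exact D.adj_det hA hC (D.adj_symm n.2.2.symm h.2.2.2) (D.adj_symm n'.2.2.symm h'.2.2.2)

lemma F_extend {A B : V} {r : Fin 7} (h : (D.pr A, D.pr B, r) ∈ torusF) (hAB : D.adj A B) :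
    ∃ C, D.pr C = r ∧ (A, B, C) ∈ D.F := by
  obtain ⟨C, hC, h1, h2⟩ := D.extend h hAB
  exact ⟨C, hC, D.mem_F.2 ⟨by rwa [hC], hAB, h1, h2⟩⟩

/-- The vertex set of a triple. -/
abbrev ts {U : Type} [DecidableEq U] (x : U × U × U) : Finset U := {x.1, x.2.1, x.2.2}

/-- Facet adjacency. -/
abbrev RC {U : Type} [DecidableEq U] (F : Finset (U × U × U)) (s t : U × U × U) : Prop :=
  s ∈ F ∧ t ∈ F ∧ 2 ≤ (({s.1, s.2.1, s.2.2} : Finset U) ∩ {t.1, t.2.1, t.2.2}).card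

/-- Facet adjacency in the star of a vertex. -/
abbrev RL {U : Type} [DecidableEq U] (F : Finset (U × U × U)) (v : U) (s t : U × U × U) : Prop :=
  s ∈ F ∧ t ∈ F ∧ v ∈ ({s.1, s.2.1, s.2.2} : Finset U) ∧ v ∈ ({t.1, t.2.1, t.2.2} : Finset U) ∧
    2 ≤ (({s.1, s.2.1, s.2.2} : Finset U) ∩ {t.1, t.2.1, t.2.2}).card

lemma rtg_symm {α : Type} {r : α → α → Prop} (hr : ∀ a b, r a b → r b a) {a b : α}
    (h : Relation.ReflTransGen r a b) : Relation.ReflTransGen r b a := by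
  induction h with
  | refl => exact .refl
  | tail _ h ih => exact .head (hr _ _ h) ih

lemma RL_symm {U : Type} [DecidableEq U] (F : Finset (U × U × U)) (v : U) (s t : U × U × U)
    (h : RL F v s t) : RL F v t s :=
  ⟨h.2.1, h.1, h.2.2.2.1, h.2.2.1, by rw [Finset.inter_comm]; exact h.2.2.2.2⟩

lemma RC_symm {U : Type} [DecidableEq U] (F : Finset (U × U × U)) (s t : U × U × U)
    (h : RC F s t) : RC F t s :=
  ⟨h.2.1, h.1, by rw [Finset.inter_comm]; exact h.2.2⟩

lemma two_le_inter {U : Type} [DecidableEq U] {s t : Finset U} {a b : U} (hab : a ≠ b)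
    (h1 : a ∈ s) (h2 : a ∈ t) (h3 : b ∈ s) (h4 : b ∈ t) : 2 ≤ (s ∩ t).card :=
  Finset.one_lt_card.2 ⟨a, Finset.mem_inter.2 ⟨h1, h2⟩, b, Finset.mem_inter.2 ⟨h3, h4⟩, hab⟩

/-- The projection of a triple to the torus. -/
def prT (X : V × V × V) : Fin 7 × Fin 7 × Fin 7 := (D.pr X.1, D.pr X.2.1, D.pr X.2.2)

lemma prT_mem {X : V × V × V} (h : X ∈ D.F) : D.prT X ∈ torusF := (D.mem_F.1 h).1

lemma ts_prT {X : V × V × V} {q : Fin 7} (h : q ∈ ts (D.prT X)) : ∃ B ∈ ts X, D.pr B = q := by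
  obtain ⟨a, b, c⟩ := X
  simp only [ts, prT, Finset.mem_insert, Finset.mem_singleton] at h ⊢
  rcases h with rfl | rfl | rfl
  · exact ⟨a, by simp, rfl⟩
  · exact ⟨b, by simp, rfl⟩
  · exact ⟨c, by simp, rfl⟩

lemma F_pair {X : V × V × V} (hX : X ∈ D.F) {A B : V} (hA : A ∈ ts X) (hB : B ∈ ts X)
    (hn : D.pr A ≠ D.pr B) : D.adj A B := by
  obtain ⟨a, b, c⟩ := X
  have nd := D.F_nd hX
  rw [mem_F] at hX
  obtain ⟨-, h1, h2, h3⟩ := hX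
  simp only [ts, Finset.mem_insert, Finset.mem_singleton] at hA hB
  rcases hA with rfl | rfl | rfl <;> rcases hB with rfl | rfl | rfl <;>
    first
      | exact absurd rfl hn
      | exact h1
      | exact h2
      | exact h3
      | exact D.adj_symm hn.symm h1
      | exact D.adj_symm hn.symm h2
      | exact D.adj_symm hn.symm h3

lemma F_over {t : Fin 7 × Fin 7 × Fin 7} (ht : t ∈ torusF) {A B : V} (hn : D.pr A ≠ D.pr B)
    (hAB : D.adj A B) (hA : D.pr A ∈ ts t) (hB : D.pr B ∈ ts t) :
    ∃ Y ∈ D.F, D.prT Y = t ∧ A ∈ ts Y ∧ B ∈ ts Y := by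
  obtain ⟨p, q, r⟩ := t
  have ht2 := torusF_rot _ ht
  have ht3 := torusF_rot _ ht2
  have hBA := D.adj_symm hn hAB
  simp only [ts, Finset.mem_insert, Finset.mem_singleton] at hA hB ht2 ht3
  rcases hA with hA | hA | hA <;> rcases hB with hB | hB | hB
  · exact absurd (hA.trans hB.symm) hn
  · subst hA hB
    obtain ⟨C, rfl, hF⟩ := D.F_extend ht hAB
    exact ⟨_, hF, rfl, by simp, by simp⟩
  · subst hA hB
    obtain ⟨C, rfl, hF⟩ := D.F_extend ht3 hBA
    exact ⟨_, D.F_rot hF, rfl, by simp, by simp⟩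
  · subst hA hB
    obtain ⟨C, rfl, hF⟩ := D.F_extend ht hBA
    exact ⟨_, hF, rfl, by simp, by simp⟩
  · exact absurd (hA.trans hB.symm) hn
  · subst hA hB
    obtain ⟨C, rfl, hF⟩ := D.F_extend ht2 hAB
    exact ⟨_, D.F_rot (D.F_rot hF), rfl, by simp, by simp⟩
  · subst hA hB
    obtain ⟨C, rfl, hF⟩ := D.F_extend ht3 hAB
    exact ⟨_, D.F_rot hF, rfl, by simp, by simp⟩
  · subst hA hB
    obtain ⟨C, rfl, hF⟩ := D.F_extend ht2 hBA
    exact ⟨_, D.F_rot (D.F_rot hF), rfl, by simp, by simp⟩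
  · exact absurd (hA.trans hB.symm) hn

lemma lift_step {X : V × V × V} (hX : X ∈ D.F) {A : V} (hA : A ∈ ts X)
    {t : Fin 7 × Fin 7 × Fin 7} (ht : t ∈ torusF) (hAt : D.pr A ∈ ts t)
    (h : 2 ≤ (ts (D.prT X) ∩ ts t).card) :
    ∃ Y ∈ D.F, D.prT Y = t ∧ A ∈ ts Y ∧ 2 ≤ (ts X ∩ ts Y).card := by
  obtain ⟨q, hq, hne⟩ := Finset.exists_mem_ne h (D.pr A)
  rw [Finset.mem_inter] at hq
  obtain ⟨B, hB, rfl⟩ := D.ts_prT hq.1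
  obtain ⟨Y, hY, e, h1, h2⟩ := D.F_over ht hne.symm (D.F_pair hX hA hB hne.symm) hAt hq.2
  refine ⟨Y, hY, e, h1, two_le_inter (a := A) (b := B) ?_ hA h1 hB h2⟩
  rintro rfl
  exact hne rfl

lemma lift_link {X : V × V × V} (hX : X ∈ D.F) {A : V} (hA : A ∈ ts X)
    {t : Fin 7 × Fin 7 × Fin 7} (h : Relation.ReflTransGen (RL torusF (D.pr A)) (D.prT X) t) :
    ∃ Y ∈ D.F, D.prT Y = t ∧ A ∈ ts Y ∧ Relation.ReflTransGen (RL D.F A) X Y := by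
  induction h with
  | refl => exact ⟨X, hX, rfl, hA, .refl⟩
  | tail _ hst ih =>
    obtain ⟨Y, hY, rfl, hAY, hp⟩ := ih
    obtain ⟨Z, hZ, e, hAZ, hc⟩ := D.lift_step hY hAY hst.2.1 hst.2.2.2.1 hst.2.2.2.2
    exact ⟨Z, hZ, e, hAZ, hp.tail ⟨hY, hZ, hAY, hAZ, hc⟩⟩

lemma lift_conn {X : V × V × V} (hX : X ∈ D.F)
    {t : Fin 7 × Fin 7 × Fin 7} (h : Relation.ReflTransGen (RC torusF) (D.prT X) t) :
    ∃ Y ∈ D.F, D.prT Y = t ∧ Relation.ReflTransGen (RC D.F) X Y := by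
  induction h with
  | refl => exact ⟨X, hX, rfl, .refl⟩
  | tail _ hst ih =>
    obtain ⟨Y, hY, rfl, hp⟩ := ih
    have hc2 := hst.2.2
    obtain ⟨p, hp'⟩ := Finset.card_pos.1 (lt_of_lt_of_le two_pos hc2)
    rw [Finset.mem_inter] at hp'
    obtain ⟨A, hA, rfl⟩ := D.ts_prT hp'.1
    obtain ⟨Z, hZ, e, hAZ, hc⟩ := D.lift_step hY hA hst.2.1 hp'.2 hc2
    exact ⟨Z, hZ, e, hp.tail ⟨hY, hZ, hc⟩⟩

lemma over_unique {X Y : V × V × V} (hX : X ∈ D.F) (hY : Y ∈ D.F) (e : D.prT X = D.prT Y)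
    {A : V} (hA : D.pr A ≠ 0) (h1 : A ∈ ts X) (h2 : A ∈ ts Y) : X = Y := by
  obtain ⟨a, b, c⟩ := X
  obtain ⟨a', b', c'⟩ := Y
  obtain ⟨n1, n2, n3⟩ := D.F_nd hX
  have key : ∀ B B', B ∈ ts (a, b, c) → B' ∈ ts (a', b', c') → D.pr B = D.pr B' → B = B' := by
    intro B B' hB hB' hp
    have fx := D.F_pair hX h1 hB
    have fy := D.F_pair hY h2 hB'
    by_cases hBA : D.pr A = D.pr B
    · have inj : ∀ {X : V × V × V}, X ∈ D.F → ∀ {C C' : V}, C ∈ ts X → C' ∈ ts X →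
          D.pr C = D.pr C' → C = C' := by
        rintro ⟨u, v, w⟩ hF C C' hC hC' hp
        obtain ⟨n1, n2, n3⟩ := D.F_nd hF
        simp only [ts, Finset.mem_insert, Finset.mem_singleton] at hC hC'
        rcases hC with rfl | rfl | rfl <;> rcases hC' with rfl | rfl | rfl <;>
          first
            | rfl
            | exact absurd hp n1
            | exact absurd hp n2
            | exact absurd hp n3
            | exact absurd hp.symm n1
            | exact absurd hp.symm n2
            | exact absurd hp.symm n3
      rw [← inj hX h1 hB hBA, inj hY h2 hB' (hBA.trans hp)]
    · exact D.adj_det hA hp (fx hBA) (fy (fun h => hBA (h.trans hp.symm)))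
  simp only [prT, Prod.mk.injEq] at e ⊢
  exact ⟨key _ _ (by simp) (by simp) e.1, key _ _ (by simp) (by simp) e.2.1,
    key _ _ (by simp) (by simp) e.2.2⟩

/-- The facet over `(0,q,r)` with sheet `i`. -/
def tri (q r : Fin 7) (i : S) : V × V × V :=
  (D.enc 0 i, D.enc q i, D.enc r (volt D.x D.z q r i))

lemma tri_mem {q r : Fin 7} (h : (0, q, r) ∈ torusF) (i : S) : D.tri q r i ∈ D.F := by
  have nd := torusF_nd _ h
  simp only at nd
  rw [tri, mem_F]
  simp only [adj, D.pr_enc, nd.1.symm, nd.2.2.symm, if_true, if_false, D.sh_enc _ _ nd.1.symm,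
    D.sh_enc _ _ nd.2.2.symm, D.hex h, and_self, and_true]
  exact h

lemma tri_step {q r r' : Fin 7} (h : (0, q, r) ∈ torusF) (h' : (0, r, r') ∈ torusF) (i j : S)
    (hj : volt D.x D.z q r i = j) :
    RL D.F (D.enc 0 i) (D.tri q r i) (D.tri r r' j) := by
  subst hj
  have nd := torusF_nd _ h
  simp only at nd
  refine ⟨D.tri_mem h i, D.tri_mem h' _, by simp [tri], by simp [tri, D.hex h], ?_⟩
  apply two_le_inter (a := D.enc 0 i) (b := D.enc r (volt D.x D.z q r i))
  · intro e
    have := congrArg D.pr e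
    rw [D.pr_enc, D.pr_enc] at this
    exact nd.2.2 this
  · simp [tri]
  · simp [tri, D.hex h]
  · simp [tri]
  · simp [tri]

lemma base_step (i : S) : Relation.ReflTransGen (RL D.F (D.enc 0 i)) (D.tri 1 3 i)
    (D.tri 1 3 ((D.x⁻¹ * D.z * D.x * D.z⁻¹) i)) := by
  have h1 := D.tri_step (q := 1) (r := 3) (r' := 2) (by decide) (by decide) i i rfl
  have h2 := D.tri_step (q := 3) (r := 2) (r' := 6) (by decide) (by decide) i i rfl
  have h3 := D.tri_step (q := 2) (r := 6) (r' := 4) (by decide) (by decide) i i rfl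
  have h4 := D.tri_step (q := 6) (r := 4) (r' := 5) (by decide) (by decide) i i rfl
  have h5 := D.tri_step (q := 4) (r := 5) (r' := 1) (by decide) (by decide) i i rfl
  have h6 := D.tri_step (q := 5) (r := 1) (r' := 3) (by decide) (by decide) i _ rfl
  exact (((((Relation.ReflTransGen.single h1).tail h2).tail h3).tail h4).tail h5).tail h6

lemma base_conn {i j : S}
    (h : Relation.EqvGen (fun a b => b = (D.x⁻¹ * D.z * D.x * D.z⁻¹) a) i j) :
    D.enc 0 i = D.enc 0 j ∧
      Relation.ReflTransGen (RL D.F (D.enc 0 i)) (D.tri 1 3 i) (D.tri 1 3 j) := by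
  induction h with
  | rel a b hab => subst hab; exact ⟨(D.enc_c a).symm, D.base_step a⟩
  | refl a => exact ⟨rfl, .refl⟩
  | symm a b _ ih => exact ⟨ih.1.symm, by rw [← ih.1]; exact rtg_symm (RL_symm _ _) ih.2⟩
  | trans a b c _ _ ih1 ih2 =>
    exact ⟨ih1.1.trans ih2.1, ih1.2.trans (by rw [ih1.1]; exact ih2.2)⟩

lemma eq_tri {Y : V × V × V} (hY : Y ∈ D.F) (e : D.prT Y = (0, 1, 3)) :
    ∃ i, Y = D.tri 1 3 i := by
  refine ⟨D.sh Y.2.1, ?_⟩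
  have e1 : D.pr Y.2.1 = 1 := congrArg (fun t => t.2.1) e
  have e2 : D.enc 1 (D.sh Y.2.1) = Y.2.1 := by rw [← e1, D.enc_eta]
  refine D.over_unique hY (D.tri_mem (by decide) _) ?_ (A := Y.2.1) ?_ (by simp) ?_
  · rw [e]; simp [prT, tri, D.pr_enc]
  · rw [e1]; decide
  · simp [tri, e2]

lemma link_conn (T : OSurf (Fin 7)) (hT : T.F = torusF) (A : V) (X : V × V × V) (hX : X ∈ D.F)
    (Y : V × V × V) (hY : Y ∈ D.F) (hAX : A ∈ ts X) (hAY : A ∈ ts Y) :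
    Relation.ReflTransGen (RL D.F A) X Y := by
  have pts : ∀ X : V × V × V, A ∈ ts X → D.pr A ∈ ts (D.prT X) := by
    intro X hX
    simp only [ts, prT, Finset.mem_insert, Finset.mem_singleton] at hX ⊢
    rcases hX with h | h | h <;> simp [h]
  by_cases hA : D.pr A = 0
  · have base : ∀ X ∈ D.F, A ∈ ts X → ∃ i, A = D.enc 0 i ∧
        Relation.ReflTransGen (RL D.F A) X (D.tri 1 3 i) := by
      intro X hX hAX
      have := T.link_connected (D.pr A) (D.prT X) (by rw [hT]; exact D.prT_mem hX) (0, 1, 3)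
        (by rw [hT]; decide) (pts X hAX) (by rw [hA]; decide)
      rw [hT] at this
      obtain ⟨Y, hY, e, hAY, hp⟩ := D.lift_link hX hAX this
      obtain ⟨i, rfl⟩ := D.eq_tri hY e
      refine ⟨i, ?_, hp⟩
      simp only [ts, tri, Finset.mem_insert, Finset.mem_singleton] at hAY
      rcases hAY with h | h | h
      · exact h
      · rw [h, D.pr_enc] at hA; exact absurd hA (by decide)
      · rw [h, D.pr_enc] at hA; exact absurd hA (by decide)
    obtain ⟨i, hi, h1⟩ := base X hX hAX
    obtain ⟨j, hj, h2⟩ := base Y hY hAY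
    have := (D.base_conn (D.enc_inj i j (hi.symm.trans hj))).2
    rw [← hi] at this
    exact (h1.trans this).trans (rtg_symm (RL_symm _ _) h2)
  · have := T.link_connected (D.pr A) (D.prT X) (by rw [hT]; exact D.prT_mem hX) (D.prT Y)
        (by rw [hT]; exact D.prT_mem hY) (pts X hAX) (pts Y hAY)
    rw [hT] at this
    obtain ⟨Z, hZ, e, hAZ, hp⟩ := D.lift_link hX hAX this
    rwa [D.over_unique hZ hY e hA hAZ hAY] at hp

lemma star_conn (T : OSurf (Fin 7)) (hT : T.F = torusF) {A : V} {X : V × V × V} (hX : X ∈ D.F)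
    {Y : V × V × V} (hY : Y ∈ D.F) (hAX : A ∈ ts X) (hAY : A ∈ ts Y) :
    Relation.ReflTransGen (RC D.F) X Y :=
  Relation.ReflTransGen.mono (fun _ _ h => ⟨h.1, h.2.1, h.2.2.2.2⟩) _ _
    (D.link_conn T hT A X hX Y hY hAX hAY)

lemma base_x (T : OSurf (Fin 7)) (hT : T.F = torusF) (i : S) :
    Relation.ReflTransGen (RC D.F) (D.tri 1 3 i) (D.tri 1 3 (D.x i)) := by
  have a12 : D.adj (D.enc 1 i) (D.enc 2 (D.x i)) := by
    simp [adj, D.pr_enc, D.sh_enc, volt]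
  obtain ⟨Y, hY, e, h1, h2⟩ := D.F_over (t := (1, 2, 4)) (by decide)
    (by rw [D.pr_enc, D.pr_enc]; decide) a12 (by rw [D.pr_enc]; decide)
    (by rw [D.pr_enc]; decide)
  have m1 := D.tri_mem (q := 1) (r := 3) (by decide) i
  have m2 := D.tri_mem (q := 3) (r := 2) (by decide) (D.x i)
  have m3 := D.tri_mem (q := 1) (r := 3) (by decide) (D.x i)
  have s1 := D.star_conn T hT m1 hY (A := D.enc 1 i) (by simp [tri]) h1
  have s2 := D.star_conn T hT hY m2 (A := D.enc 2 (D.x i)) h2 (by simp [tri, volt])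
  have s3 := D.star_conn T hT m2 m3 (A := D.enc 3 (D.x i)) (by simp [tri]) (by simp [tri, volt])
  exact (s1.trans s2).trans s3

lemma conn (T : OSurf (Fin 7)) (hT : T.F = torusF) (X : V × V × V) (hX : X ∈ D.F)
    (Y : V × V × V) (hY : Y ∈ D.F) : Relation.ReflTransGen (RC D.F) X Y := by
  have base : ∀ X ∈ D.F, ∃ i, Relation.ReflTransGen (RC D.F) X (D.tri 1 3 i) := by
    intro X hX
    have := T.connected (D.prT X) (by rw [hT]; exact D.prT_mem hX) (0, 1, 3)
      (by rw [hT]; decide)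
    rw [hT] at this
    obtain ⟨Y, hY, e, hp⟩ := D.lift_conn hX this
    obtain ⟨i, rfl⟩ := D.eq_tri hY e
    exact ⟨i, hp⟩
  obtain ⟨i, h1⟩ := base X hX
  obtain ⟨j, h2⟩ := base Y hY
  have h3 : Relation.ReflTransGen (RC D.F) (D.tri 1 3 i) (D.tri 1 3 j) := by
    have := D.trans i j
    clear h1 h2
    induction this with
    | rel a b hab => subst hab; exact D.base_x T hT a
    | refl a => exact .refl
    | symm a b _ ih => exact rtg_symm (RC_symm _) ih
    | trans a b c _ _ ih1 ih2 => exact ih1.trans ih2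
  exact (h1.trans h3).trans (rtg_symm (RC_symm _) h2)

/-- The covering surface. -/
noncomputable def surf (T : OSurf (Fin 7)) (hT : T.F = torusF) : OSurf V where
  F := D.F
  rot_mem _ _ _ h := D.F_rot h
  nondegen a b c h := by
    obtain ⟨h1, h2, h3⟩ := D.F_nd h
    exact ⟨fun e => h1 (congrArg _ e), fun e => h2 (congrArg _ e), fun e => h3 (congrArg _ e)⟩
  dart_unique a b c c' h h' := by
    refine D.F_unique h h' ?_
    have m := D.prT_mem h
    have m' := D.prT_mem h'
    rw [← hT] at m m'
    exact T.dart_unique _ _ _ _ m m'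
  dart_rev a b c h := by
    have m := D.prT_mem h
    rw [← hT] at m
    obtain ⟨r, hr⟩ := T.dart_rev _ _ _ m
    rw [hT] at hr
    obtain ⟨C, -, hC⟩ := D.F_extend hr
      (D.adj_symm (D.F_nd h).1 (D.mem_F.1 h).2.1)
    exact ⟨C, hC⟩
  vertex_cover v := by
    by_cases hv : D.pr v = 0
    · have := D.tri_mem (q := 1) (r := 3) (by decide) (D.sh v)
      rw [tri, ← hv, D.enc_eta] at this
      exact ⟨_, _, this⟩
    · obtain ⟨b, c, h⟩ := T.vertex_cover (D.pr v)
      rw [hT] at h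
      have nd := torusF_nd _ h
      simp only at nd
      have : ∃ B, D.pr B = b ∧ D.adj v B := by
        by_cases hb : b = 0
        · exact ⟨D.enc 0 (D.sh v), by rw [D.pr_enc, hb], by simp [adj, hv, D.pr_enc]⟩
        · exact ⟨D.enc b (volt D.x D.z (D.pr v) b (D.sh v)), D.pr_enc _ _,
            by simp [adj, hv, hb, D.pr_enc, D.sh_enc]⟩
      obtain ⟨B, rfl, hB⟩ := this
      obtain ⟨C, -, hC⟩ := D.F_extend h hB
      exact ⟨B, C, hC⟩
  connected X hX Y hY := D.conn T hT X hX Y hY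
  link_connected v X hX Y hY h1 h2 := D.link_conn T hT v X hX Y hY h1 h2

lemma surf_simplicial (T : OSurf (Fin 7)) (hT : T.F = torusF) :
    IsSimplicialMap (D.surf T hT) T D.pr := by
  intro X hX
  refine ⟨{D.pr X.1, D.pr X.2.1, D.pr X.2.2}, ?_, subset_rfl⟩
  have := D.prT_mem hX
  rw [← hT] at this
  exact Finset.mem_image_of_mem (fun x : Fin 7 × Fin 7 × Fin 7 => ({x.1, x.2.1, x.2.2} : Finset _))
    this

lemma exists_over {A : V} (hv : D.pr A ≠ 0) {q r : Fin 7} (h : (D.pr A, q, r) ∈ torusF) :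
    ∃ B C, (A, B, C) ∈ D.F ∧ D.pr B = q ∧ D.pr C = r := by
  have : ∃ B, D.pr B = q ∧ D.adj A B := by
    by_cases hb : q = 0
    · exact ⟨D.enc 0 (D.sh A), by rw [D.pr_enc, hb], by simp [adj, hv, D.pr_enc]⟩
    · exact ⟨D.enc q (volt D.x D.z (D.pr A) q (D.sh A)), D.pr_enc _ _,
        by simp [adj, hv, hb, D.pr_enc, D.sh_enc]⟩
  obtain ⟨B, rfl, hB⟩ := this
  obtain ⟨C, hr, hC⟩ := D.F_extend h hB
  exact ⟨B, C, hC, rfl, hr⟩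

lemma fiber_card_aux [Fintype S] {p q r : Fin 7} (hp : p ≠ 0) (h : (p, q, r) ∈ torusF) :
    (D.F.filter fun X => (D.pr X.1, D.pr X.2.1, D.pr X.2.2) = (p, q, r)).card =
      Fintype.card S := by
  rw [← Finset.card_univ]
  apply Finset.card_bij (fun X _ => D.sh X.1)
  · intro X _; exact Finset.mem_univ _
  · intro X hX Y hY e
    rw [Finset.mem_filter] at hX hY
    have e1 : D.pr X.1 = p := congrArg (fun t => t.1) hX.2
    have e2 : D.pr Y.1 = p := congrArg (fun t => t.1) hY.2
    have e3 : X.1 = Y.1 := by rw [← D.enc_eta X.1, ← D.enc_eta Y.1, e1, e2, e]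
    exact D.over_unique hX.1 hY.1 (hX.2.trans hY.2.symm) (A := X.1) (by rw [e1]; exact hp)
      (by simp) (by rw [e3]; simp)
  · intro i _
    obtain ⟨B, C, hF, hB, hC⟩ := D.exists_over (A := D.enc p i) (q := q) (r := r)
      (by rw [D.pr_enc]; exact hp) (by rw [D.pr_enc]; exact h)
    refine ⟨(D.enc p i, B, C), ?_, D.sh_enc _ _ hp⟩
    rw [Finset.mem_filter]
    refine ⟨hF, ?_⟩
    simp only [D.pr_enc, hB, hC]

lemma fiber_card [Fintype S] (T : OSurf (Fin 7)) (hT : T.F = torusF) {p q r : Fin 7}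
    (h : (p, q, r) ∈ torusF) :
    (D.F.filter fun X => (D.pr X.1, D.pr X.2.1, D.pr X.2.2) = (p, q, r)).card =
      Fintype.card S := by
  by_cases hp : p = 0
  · have nd := torusF_nd _ h
    simp only at nd
    rw [← D.fiber_card_aux (fun hq => nd.1 (hp.trans hq.symm)) (torusF_rot _ h)]
    exact count_rot (D.surf T hT) D.pr p q r
  · exact D.fiber_card_aux hp h

lemma surf_degree [Fintype S] (T : OSurf (Fin 7)) (hT : T.F = torusF) :
    HasDegree (D.surf T hT) T D.pr (Fintype.card S) := by
  intro p q r h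
  rw [hT] at h
  have h1 := D.fiber_card T hT h
  have h2 : (D.F.filter fun X => (D.pr X.1, D.pr X.2.1, D.pr X.2.2) = (p, r, q)) = ∅ := by
    rw [Finset.filter_eq_empty_iff]
    intro X hX e
    have := D.prT_mem hX
    rw [prT, e] at this
    exact torusF_rev' _ h this
  change ((D.F.filter _).card : ℤ) - ((D.F.filter _).card : ℤ) = _
  rw [h1, h2]
  simp

lemma surf_genus [Fintype S] (T : OSurf (Fin 7)) (hT : T.F = torusF) (g : ℕ)
    (hV : (Fintype.card V : ℤ) = 7 * Fintype.card S + 2 - 2 * g) :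
    (D.surf T hT).genusIs g := by
  have h1 := two_edges_eq (D.surf T hT)
  have h2 := three_faces_eq (D.surf T hT) (by
    intro a b c h h'
    exact torusF_rev _ (D.prT_mem h) (D.prT_mem h'))
  have h3 : (D.surf T hT).F.card = 42 * Fintype.card S := by
    change D.F.card = _
    rw [Finset.card_eq_sum_card_fiberwise (f := D.prT) (t := torusF)
      (fun X hX => D.prT_mem hX), ← torusF_card, ← smul_eq_mul, ← Finset.sum_const]
    apply Finset.sum_congr rfl
    intro t ht
    exact D.fiber_card T hT ht
  unfold OSurf.genusIs
  omega

end Cov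

/-- The cyclic shift of the sheets. -/
def shiftPerm (n : ℕ) : Equiv.Perm (Fin n) where
  toFun i := ⟨if i.val + 1 = n then 0 else i.val + 1, by have := i.isLt; split_ifs <;> omega⟩
  invFun i := ⟨if i.val = 0 then n - 1 else i.val - 1, by have := i.isLt; split_ifs <;> omega⟩
  left_inv i := by
    ext
    have := i.isLt
    grind
  right_inv i := by
    ext
    have := i.isLt
    grind

/-- The reversal of the sheets `1, …, r`. -/
def flipPerm (n r : ℕ) (hr : r < n) : Equiv.Perm (Fin n) where
  toFun i := ⟨if 1 ≤ i.val ∧ i.val ≤ r then r + 1 - i.val else i.val,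
    by have := i.isLt; split_ifs <;> omega⟩
  invFun i := ⟨if 1 ≤ i.val ∧ i.val ≤ r then r + 1 - i.val else i.val,
    by have := i.isLt; split_ifs <;> omega⟩
  left_inv i := by
    ext
    have := i.isLt
    simp only
    split_ifs <;> omega
  right_inv i := by
    ext
    have := i.isLt
    simp only
    split_ifs <;> omega

lemma comm_val (n r : ℕ) (hr : r < n) (i : Fin n) :
    (((shiftPerm n)⁻¹ * flipPerm n r hr * shiftPerm n * (flipPerm n r hr)⁻¹) i).val =
      if i.val ≤ r then (if 2 ≤ i.val then i.val - 2 else i.val + r - 1) else i.val := by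
  have h0 := i.isLt
  have e1 : ∀ j : Fin n, ((flipPerm n r hr)⁻¹ j).val =
    if 1 ≤ j.val ∧ j.val ≤ r then r + 1 - j.val else j.val := fun _ => rfl
  have e2 : ∀ j : Fin n, ((flipPerm n r hr) j).val =
    if 1 ≤ j.val ∧ j.val ≤ r then r + 1 - j.val else j.val := fun _ => rfl
  have e3 : ∀ j : Fin n, (shiftPerm n j).val =
    if j.val + 1 = n then 0 else j.val + 1 := fun _ => rfl
  have e4 : ∀ j : Fin n, ((shiftPerm n)⁻¹ j).val =
    if j.val = 0 then n - 1 else j.val - 1 := fun _ => rfl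
  simp only [Equiv.Perm.mul_apply, e1, e2, e3, e4]
  grind

lemma shift_conn (n : ℕ) (i j : Fin n) :
    Relation.EqvGen (fun a b => b = shiftPerm n a) i j := by
  have key : ∀ (m : ℕ) (hm : m < n),
      Relation.EqvGen (fun a b => b = shiftPerm n a) ⟨0, by omega⟩ ⟨m, hm⟩ := by
    intro m
    induction m with
    | zero => intro _; exact .refl _
    | succ m ih =>
      intro hm
      refine .trans _ _ _ (ih (by omega)) (.rel _ _ ?_)
      ext
      simp only [shiftPerm, Equiv.coe_fn_mk]
      rw [if_neg (by omega)]
  exact .trans _ _ _ (.symm _ _ (key i.val i.isLt)) (key j.val j.isLt)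

lemma comm_conn (n r : ℕ) (hr : r < n) (he : Even r) (i j : Fin n) (hi : i.val ≤ r)
    (hj : j.val ≤ r) : Relation.EqvGen (fun a b => b =
      ((shiftPerm n)⁻¹ * flipPerm n r hr * shiftPerm n * (flipPerm n r hr)⁻¹) a) i j := by
  have step : ∀ (m : ℕ) (hm : m + 2 ≤ r), Relation.EqvGen (fun a b => b =
      ((shiftPerm n)⁻¹ * flipPerm n r hr * shiftPerm n * (flipPerm n r hr)⁻¹) a)
      ⟨m + 2, by omega⟩ ⟨m, by omega⟩ := by
    intro m hm
    apply Relation.EqvGen.rel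
    ext
    rw [comm_val]
    simp only
    split_ifs <;> omega
  have even : ∀ (m : ℕ) (hm : 2 * m ≤ r), Relation.EqvGen (fun a b => b =
      ((shiftPerm n)⁻¹ * flipPerm n r hr * shiftPerm n * (flipPerm n r hr)⁻¹) a)
      ⟨2 * m, by omega⟩ ⟨0, by omega⟩ := by
    intro m
    induction m with
    | zero => intro _; exact .refl _
    | succ m ih => intro hm; exact .trans _ _ _ (step (2 * m) hm) (ih (by omega))
  have odd : ∀ (m : ℕ) (hm : 2 * m + 1 ≤ r), Relation.EqvGen (fun a b => b =
      ((shiftPerm n)⁻¹ * flipPerm n r hr * shiftPerm n * (flipPerm n r hr)⁻¹) a)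
      ⟨2 * m + 1, by omega⟩ ⟨0, by omega⟩ := by
    intro m
    induction m with
    | zero =>
      intro hm
      obtain ⟨s, hs⟩ := he
      refine .trans _ _ _ (.rel _ ⟨2 * s, by omega⟩ ?_) (even s (by omega))
      ext
      rw [comm_val]
      simp only
      split_ifs <;> omega
    | succ m ih => intro hm; exact .trans _ _ _ (step (2 * m + 1) hm) (ih (by omega))
  have all : ∀ i : Fin n, i.val ≤ r → Relation.EqvGen (fun a b => b =
      ((shiftPerm n)⁻¹ * flipPerm n r hr * shiftPerm n * (flipPerm n r hr)⁻¹) a)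
      i ⟨0, by omega⟩ := by
    rintro ⟨i, hin⟩ hi
    rcases Nat.even_or_odd' i with ⟨m, rfl | rfl⟩
    · exact even m hi
    · exact odd m hi
  exact .trans _ _ _ (all i hi) (.symm _ _ (all j hj))

/-- The branched cover: `n` sheets, one branch point of index `r + 1` over the vertex `0`. -/
def theCov (n r N : ℕ) (hr : r < n) (he : Even r) (hN : N + r = 7 * n) :
    Cov (Fin n) (Fin N) where
  x := shiftPerm n
  z := flipPerm n r hr
  pr A := ⟨(A.val + r) / n, by
    rw [Nat.div_lt_iff_lt_mul (by omega)]; have := A.isLt; omega⟩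
  sh A := ⟨(A.val + r) % n, Nat.mod_lt _ (by omega)⟩
  enc p i := ⟨p.val * n + i.val - r, by
    have h1 := i.isLt
    have : p.val * n ≤ 6 * n := Nat.mul_le_mul_right _ (by omega)
    omega⟩
  pr_enc p i := by
    ext
    have h1 := i.isLt
    simp only
    by_cases hp : p.val = 0
    · rw [hp, Nat.div_eq_of_lt]; omega
    · have : 1 * n ≤ p.val * n := Nat.mul_le_mul_right _ (by omega)
      rw [Nat.sub_add_cancel (by omega), mul_comm, Nat.mul_add_div (by omega),
        Nat.div_eq_of_lt h1]
      rfl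
  sh_enc p i hp := by
    ext
    have h1 := i.isLt
    simp only
    have hp' : p.val ≠ 0 := fun h => hp (Fin.ext h)
    have : 1 * n ≤ p.val * n := Nat.mul_le_mul_right _ (by omega)
    rw [Nat.sub_add_cancel (by omega), mul_comm, Nat.mul_add_mod, Nat.mod_eq_of_lt h1]
  enc_eta A := by
    ext
    simp only
    rw [mul_comm, Nat.div_add_mod]
    omega
  enc_c i := by
    ext
    simp only [comm_val]
    have : ((0 : Fin 7).val) * n = 0 := by simp
    rw [this]
    split_ifs <;> omega
  enc_inj i j h := by
    have h' := congrArg Fin.val h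
    simp only at h'
    have e : ((0 : Fin 7).val) * n = 0 := by simp
    rw [e] at h'
    by_cases hi : i.val ≤ r
    · exact comm_conn n r hr he i j hi (by omega)
    · have : i = j := Fin.ext (by omega)
      rw [this]
      exact .refl _
  trans := shift_conn n

end Cover

/-- For every `g ≥ 1` and every integer `d` with `|d| ≥ 2g - 1`
there is a triangulation of the closed orientable genus `g` surface with
`7|d| + 2 - 2g` vertices admitting a simplicial map of degree `d` to the
`7`-vertex torus, and no triangulation with fewer vertices admits such a map. -/
theorem stmt12 (g : ℕ) (hg : 1 ≤ g) (d : ℤ) (hd : 2 * (g : ℤ) - 1 ≤ |d|)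
    (T : OSurf (Fin 7)) (hT : T.F = torusF) :
    (∃ K : OSurf (Fin (7 * d.natAbs + 2 - 2 * g)), K.genusIs g ∧
      ∃ φ : Fin (7 * d.natAbs + 2 - 2 * g) → Fin 7,
        IsSimplicialMap K T φ ∧ HasDegree K T φ d) ∧
    ∀ (V : Type) [DecidableEq V] [Fintype V] (K : OSurf V) (φ : V → Fin 7),
      K.genusIs g → IsSimplicialMap K T φ → HasDegree K T φ d →
      7 * |d| + 2 - 2 * (g : ℤ) ≤ (Fintype.card V : ℤ) := by
  have hn : 2 * g - 1 ≤ d.natAbs := by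
    rw [Int.abs_eq_natAbs] at hd
    omega
  have hN : (7 * d.natAbs + 2 - 2 * g) + (2 * g - 2) = 7 * d.natAbs := by omega
  refine ⟨?_, fun V _ _ K φ hK _ hdeg => lower_bound g T hT K φ d hK hdeg⟩
  let D := theCov d.natAbs (2 * g - 2) (7 * d.natAbs + 2 - 2 * g) (by omega)
    ⟨g - 1, by omega⟩ hN
  have h1 : (D.surf T hT).genusIs g := by
    apply D.surf_genus
    rw [Fintype.card_fin, Fintype.card_fin]
    omega
  have h2 := D.surf_simplicial T hT
  have h3 := D.surf_degree T hT
  rw [Fintype.card_fin] at h3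
  rcases Int.natAbs_eq d with h | h
  · exact ⟨D.surf T hT, h1, D.pr, h2, by rw [← h] at h3; exact h3⟩
  · refine ⟨(D.surf T hT).rev, rev_genus _ _ h1, D.pr, rev_simplicial _ _ _ h2, ?_⟩
    have h4 := rev_degree _ _ _ _ h3
    rw [← h] at h4
    exact h4
end

section
/- For g ≥ 2 and any integer i with 0 ≤ i ≤ g - 2, there exists a triangulation of the closed orientable genus g surface with 6(g + i) + 1 vertices admitting a simplicial map of degree g + i onto the 7-vertex triangulation of the torus. -/
variable {V W : Type} [DecidableEq V] [Fintype V] [DecidableEq W] [Fintype W]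

namespace Surg

/-- Support of an oriented triple. -/
def sp {V : Type} [DecidableEq V] (x : V × V × V) : Finset V := {x.1, x.2.1, x.2.2}

/-- Apply a map to the three vertices of a triple. -/
def mp {V W : Type} (f : V → W) (x : V × V × V) : W × W × W := (f x.1, f x.2.1, f x.2.2)

lemma sp_mp {V W : Type} [DecidableEq V] [DecidableEq W] (f : V → W) (x : V × V × V) :
    sp (mp f x) = (sp x).image f := by
  simp [sp, mp, Finset.image_insert]

lemma mp_inj {V W : Type} {f : V → W} (hf : Function.Injective f) :
    Function.Injective (mp f) := by
  rintro ⟨a, b, c⟩ ⟨a', b', c'⟩ h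
  simp only [mp, Prod.mk.injEq] at h
  simp [hf h.1, hf h.2.1, hf h.2.2]

/-- Adjacency of facets containing `S`. -/
def Rel {V : Type} [DecidableEq V] (F : Finset (V × V × V)) (S : Finset V)
    (s t : V × V × V) : Prop :=
  s ∈ F ∧ t ∈ F ∧ S ⊆ sp s ∧ S ⊆ sp t ∧ 2 ≤ (sp s ∩ sp t).card

/-- The facets containing `S` are strongly connected. -/
def Conn {V : Type} [DecidableEq V] (F : Finset (V × V × V)) (S : Finset V) : Prop :=
  ∀ x ∈ F, ∀ y ∈ F, S ⊆ sp x → S ⊆ sp y → Relation.ReflTransGen (Rel F S) x y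

lemma Rel.symm {V : Type} [DecidableEq V] {F : Finset (V × V × V)} {S : Finset V}
    {s t : V × V × V} (h : Rel F S s t) : Rel F S t s :=
  ⟨h.2.1, h.1, h.2.2.2.1, h.2.2.1, by rw [Finset.inter_comm]; exact h.2.2.2.2⟩

lemma rtg_symm {V : Type} [DecidableEq V] {F : Finset (V × V × V)} {S : Finset V}
    {s t : V × V × V} (h : Relation.ReflTransGen (Rel F S) s t) :
    Relation.ReflTransGen (Rel F S) t s := by
  induction h with
  | refl => exact .refl
  | tail _ h ih => exact .head h.symm ih

lemma two_le_inter {V : Type} [DecidableEq V] {A B : Finset V} {a b : V} (hab : a ≠ b)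
    (h1 : a ∈ A) (h2 : b ∈ A) (h3 : a ∈ B) (h4 : b ∈ B) : 2 ≤ (A ∩ B).card := by
  have : 1 < (A ∩ B).card :=
    Finset.one_lt_card.2 ⟨a, by simp [h1, h3], b, by simp [h2, h4], hab⟩
  omega

lemma rtg_map {X Y : Type} {r : X → X → Prop} {q : Y → Y → Prop} (f : X → Y)
    (h : ∀ a b, r a b → q (f a) (f b)) {x y : X} (hxy : Relation.ReflTransGen r x y) :
    Relation.ReflTransGen q (f x) (f y) := by
  induction hxy with
  | refl => exact .refl
  | tail _ hab ih => exact ih.tail (h _ _ hab)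

/-- Lift a path along an injective map. -/
lemma rtg_lift {V W : Type} [DecidableEq V] [DecidableEq W] {f : V → W}
    (hf : Function.Injective f) {F : Finset (V × V × V)} {G : Finset (W × W × W)}
    {S : Finset V} (hFG : ∀ x ∈ F, S ⊆ sp x → mp f x ∈ G) {x y : V × V × V}
    (h : Relation.ReflTransGen (Rel F S) x y) :
    Relation.ReflTransGen (Rel G (S.image f)) (mp f x) (mp f y) := by
  refine rtg_map (mp f) ?_ h
  rintro s t ⟨h1, h2, h3, h4, h5⟩
  refine ⟨hFG _ h1 h3, hFG _ h2 h4, ?_, ?_, ?_⟩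
  · rw [sp_mp]; exact Finset.image_subset_image h3
  · rw [sp_mp]; exact Finset.image_subset_image h4
  · rw [sp_mp, sp_mp, ← Finset.image_inter _ _ hf, Finset.card_image_of_injective _ hf]; exact h5

/-- Combinatorial conditions for the patch `P` to replace the disc `D`. -/
structure Piece {B U : Type} [DecidableEq B] [DecidableEq U] (β : B → U)
    (D : Finset (B × B × B)) (P : Finset (U × U × U)) : Prop where
  drot : ∀ x ∈ D, (x.2.1, x.2.2, x.1) ∈ D
  rot : ∀ x ∈ P, (x.2.1, x.2.2, x.1) ∈ P
  nondeg : ∀ x ∈ P, x.1 ≠ x.2.1 ∧ x.2.1 ≠ x.2.2 ∧ x.1 ≠ x.2.2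
  anti : ∀ x ∈ P, (x.2.1, x.1, x.2.2) ∉ P
  uniq : ∀ x ∈ P, ∀ y ∈ P, x.1 = y.1 → x.2.1 = y.2.1 → x.2.2 = y.2.2
  inner : ∀ x ∈ P, ∀ s t, x.1 = β s → x.2.1 = β t → ∃ u, (s, t, u) ∈ D
  full : ∀ x ∈ P, ∀ s t u, x.1 = β s → x.2.1 = β t → x.2.2 = β u → (s, t, u) ∈ D
  rev : ∀ x ∈ P, (∃ u, (x.2.1, x.1, u) ∈ P) ∨
    ∃ s t, x.1 = β s ∧ x.2.1 = β t ∧ (∃ u, (s, t, u) ∈ D) ∧ ∀ u, (t, s, u) ∉ D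
  drev : ∀ x ∈ D, (∃ u, (x.2.1, x.1, u) ∈ D) ∨ ∃ u, (β x.1, β x.2.1, u) ∈ P
  edge : ∀ d ∈ D, ∀ s ∈ sp d, ∀ t ∈ sp d, s ≠ t →
    (∃ x ∈ P, β s ∈ sp x ∧ β t ∈ sp x) ∨ ((∃ u, (s, t, u) ∈ D) ∧ ∃ u, (t, s, u) ∈ D)
  cover : ∀ v, ∃ b c, (v, b, c) ∈ P
  dcover : ∀ b, ∃ d ∈ D, b ∈ sp d
  dne : D.Nonempty
  conn0 : Conn P ∅
  conn1 : ∀ v, Conn P {v}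

/-- Two vertices of a facet: some rotation starts with them. -/
lemma two_mem {V : Type} [DecidableEq V] {F : Finset (V × V × V)}
    (hr : ∀ a b c, (a, b, c) ∈ F → (b, c, a) ∈ F) {x : V × V × V} (hx : x ∈ F) {a b : V}
    (hab : a ≠ b) (ha : a ∈ sp x) (hb : b ∈ sp x) :
    ∃ c, ((a, b, c) ∈ F ∧ sp (a, b, c) = sp x ∧ (x = (a,b,c) ∨ x = (b,c,a) ∨ x = (c,a,b))) ∨
      ((b, a, c) ∈ F ∧ sp (b, a, c) = sp x ∧ (x = (b,a,c) ∨ x = (a,c,b) ∨ x = (c,b,a))) := by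
  obtain ⟨p, q, r⟩ := x
  have h1 := hr _ _ _ hx
  have h2 := hr _ _ _ h1
  simp only [sp, Finset.mem_insert, Finset.mem_singleton] at ha hb
  have e1 : sp (q, r, p) = sp (p, q, r) := by ext; simp [sp]; tauto
  have e2 : sp (r, p, q) = sp (p, q, r) := by ext; simp [sp]; tauto
  rcases ha with rfl | rfl | rfl <;> rcases hb with rfl | rfl | rfl <;>
    first
    | exact absurd rfl hab
    | exact ⟨_, Or.inl ⟨hx, rfl, by simp⟩⟩
    | exact ⟨_, Or.inl ⟨h1, e1, by simp⟩⟩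
    | exact ⟨_, Or.inl ⟨h2, e2, by simp⟩⟩
    | exact ⟨_, Or.inr ⟨hx, rfl, by simp⟩⟩
    | exact ⟨_, Or.inr ⟨h1, e1, by simp⟩⟩
    | exact ⟨_, Or.inr ⟨h2, e2, by simp⟩⟩

section surgery

variable {V W B U : Type} [DecidableEq V] [DecidableEq W] [DecidableEq B] [DecidableEq U]

/-- The facets after the surgery. -/
def newF (j : V → W) (ι : U → W) (κ : B → V) (A : Finset (V × V × V))
    (D : Finset (B × B × B)) (P : Finset (U × U × U)) : Finset (W × W × W) :=
  (A \ D.image (mp κ)).image (mp j) ∪ P.image (mp ι)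

/-- Gluing maps. -/
structure Glue (j : V → W) (ι : U → W) (κ : B → V) (β : B → U) : Prop where
  hj : Function.Injective j
  hι : Function.Injective ι
  hκ : Function.Injective κ
  comm : ∀ b, ι (β b) = j (κ b)
  ovl : ∀ v u, j v = ι u → ∃ b, v = κ b ∧ u = β b
  cov : ∀ w, (∃ v, w = j v) ∨ ∃ u, w = ι u

variable {j : V → W} {ι : U → W} {κ : B → V} {β : B → U} {A : Finset (V × V × V)}
    {D : Finset (B × B × B)} {P : Finset (U × U × U)}

lemma mem_newF {m : W × W × W} : m ∈ newF j ι κ A D P ↔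
    (∃ x ∈ A, x ∉ D.image (mp κ) ∧ m = mp j x) ∨ ∃ x ∈ P, m = mp ι x := by
  simp only [newF, Finset.mem_union, Finset.mem_image, Finset.mem_sdiff]
  constructor
  · rintro (⟨x, ⟨h1, h2⟩, rfl⟩ | ⟨x, h, rfl⟩)
    · exact Or.inl ⟨x, h1, h2, rfl⟩
    · exact Or.inr ⟨x, h, rfl⟩
  · rintro (⟨x, h1, h2, rfl⟩ | ⟨x, h, rfl⟩)
    · exact Or.inl ⟨x, ⟨h1, h2⟩, rfl⟩
    · exact Or.inr ⟨x, h, rfl⟩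

lemma Glue.hβ (G : Glue j ι κ β) : Function.Injective β := by
  intro a b h
  apply G.hκ; apply G.hj
  rw [← G.comm, ← G.comm, h]

lemma dimg_rot (hp : Piece β D P) {a b c : V} (h : (a, b, c) ∈ D.image (mp κ)) :
    (b, c, a) ∈ D.image (mp κ) := by
  obtain ⟨d, hd, e⟩ := Finset.mem_image.1 h
  simp only [mp, Prod.mk.injEq] at e
  obtain ⟨rfl, rfl, rfl⟩ := e
  exact Finset.mem_image.2 ⟨_, hp.drot d hd, rfl⟩

lemma in_dimg (hu : ∀ a b c c', (a, b, c) ∈ A → (a, b, c') ∈ A → c = c')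
    (hD : ∀ d ∈ D, mp κ d ∈ A) {s t : B} {c : V} (hx : (κ s, κ t, c) ∈ A)
    (h : ∃ u, (s, t, u) ∈ D) : (κ s, κ t, c) ∈ D.image (mp κ) := by
  obtain ⟨u, hu'⟩ := h
  have := hu _ _ _ _ hx (hD _ hu')
  rw [this]
  exact Finset.mem_image.2 ⟨_, hu', rfl⟩

lemma attach (hp : Piece β D P) (G : Glue j ι κ β)
    (hr : ∀ a b c, (a, b, c) ∈ A → (b, c, a) ∈ A)
    (hu : ∀ a b c c', (a, b, c) ∈ A → (a, b, c') ∈ A → c = c')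
    (hD : ∀ d ∈ D, mp κ d ∈ A) (S : Finset B) (hS : S.card ≤ 1) (hc : Conn A (S.image κ))
    (x : V × V × V) (hx : x ∈ A) (hxD : x ∉ D.image (mp κ)) (hxS : S.image κ ⊆ sp x) :
    ∃ t ∈ P, S.image β ⊆ sp t ∧
      Relation.ReflTransGen (Rel (newF j ι κ A D P) ((S.image κ).image j)) (mp j x) (mp ι t) := by
  obtain ⟨d, hd, hSd⟩ : ∃ d ∈ D, S ⊆ sp d := by
    by_cases he : S = ∅
    · obtain ⟨d, hd⟩ := hp.dne; exact ⟨d, hd, by simp [he]⟩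
    · obtain ⟨b, hb⟩ := Finset.nonempty_iff_ne_empty.2 he
      obtain ⟨d, hd, hbd⟩ := hp.dcover b
      refine ⟨d, hd, fun y hy => ?_⟩
      rwa [Finset.card_le_one.1 hS y hy b hb]
  have path := hc x hx _ (hD d hd) hxS (by rw [sp_mp]; exact Finset.image_subset_image hSd)
  have hdm : mp κ d ∈ D.image (mp κ) := Finset.mem_image_of_mem _ hd
  induction path using Relation.ReflTransGen.head_induction_on with
  | refl => exact absurd hdm hxD
  | @head x z hxz _ ih =>
    obtain ⟨_, hz, _, hzS, hcard⟩ := hxz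
    have hxF : mp j x ∈ newF j ι κ A D P := mem_newF.2 (Or.inl ⟨x, hx, hxD, rfl⟩)
    have hxS' : (S.image κ).image j ⊆ sp (mp j x) := by
      rw [sp_mp]; exact Finset.image_subset_image hxS
    by_cases hzD : z ∈ D.image (mp κ)
    · obtain ⟨e, he, rfl⟩ := Finset.mem_image.1 hzD
      obtain ⟨p, q, hpq, hp1, hq1, hSpq⟩ : ∃ p q, p ≠ q ∧ p ∈ sp x ∩ sp (mp κ e) ∧
          q ∈ sp x ∩ sp (mp κ e) ∧ S.image κ ⊆ {p, q} := by
        by_cases h0 : S = ∅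
        · obtain ⟨p, h1, q, h2, h3⟩ := Finset.one_lt_card.1 (show 1 < _ from hcard)
          exact ⟨p, q, h3, h1, h2, by simp [h0]⟩
        · obtain ⟨b, hb⟩ := Finset.nonempty_iff_ne_empty.2 h0
          have hb' : κ b ∈ S.image κ := Finset.mem_image_of_mem _ hb
          obtain ⟨q, h1, h2⟩ := Finset.exists_mem_ne (show 1 < _ from hcard) (κ b)
          refine ⟨κ b, q, h2.symm, Finset.mem_inter.2 ⟨hxS hb', hzS hb'⟩, h1, ?_⟩
          intro y hy
          obtain ⟨b', hb2, rfl⟩ := Finset.mem_image.1 hy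
          simp [Finset.card_le_one.1 hS b' hb2 b hb]
      rw [Finset.mem_inter, sp_mp] at hp1 hq1
      obtain ⟨hpx, hpe⟩ := hp1
      obtain ⟨hqx, hqe⟩ := hq1
      obtain ⟨s, hs, rfl⟩ := Finset.mem_image.1 hpe
      obtain ⟨t, ht, rfl⟩ := Finset.mem_image.1 hqe
      have hst : s ≠ t := fun h => hpq (by rw [h])
      rcases hp.edge e he s hs t ht hst with ⟨y, hy, h1, h2⟩ | ⟨h1, h2⟩
      · have hSy : S.image β ⊆ sp y := by
          intro u hu'
          obtain ⟨b, hb, rfl⟩ := Finset.mem_image.1 hu'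
          have := hSpq (Finset.mem_image_of_mem κ hb)
          simp only [Finset.mem_insert, Finset.mem_singleton] at this
          rcases this with h | h
          · rwa [G.hκ h]
          · rwa [G.hκ h]
        refine ⟨y, hy, hSy, Relation.ReflTransGen.single ⟨hxF, mem_newF.2 (Or.inr ⟨y, hy, rfl⟩),
          hxS', ?_, ?_⟩⟩
        · rw [sp_mp]
          intro w hw
          simp only [Finset.mem_image] at hw
          obtain ⟨_, ⟨b, hb, rfl⟩, rfl⟩ := hw
          rw [← G.comm]
          exact Finset.mem_image_of_mem _ (hSy (Finset.mem_image_of_mem _ hb))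
        · rw [sp_mp, sp_mp]
          refine two_le_inter (a := j (κ s)) (b := j (κ t)) (fun h => hpq (G.hj h))
            (Finset.mem_image_of_mem _ hpx) (Finset.mem_image_of_mem _ hqx) ?_ ?_
          · rw [← G.comm]; exact Finset.mem_image_of_mem _ h1
          · rw [← G.comm]; exact Finset.mem_image_of_mem _ h2
      · exfalso
        obtain ⟨c, ⟨hc1, _, hc2⟩ | ⟨hc1, _, hc2⟩⟩ := two_mem hr hx hpq hpx hqx
        · have := in_dimg hu hD hc1 h1
          rcases hc2 with rfl | rfl | rfl
          · exact hxD this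
          · exact hxD (dimg_rot hp this)
          · exact hxD (dimg_rot hp (dimg_rot hp this))
        · have := in_dimg hu hD hc1 h2
          rcases hc2 with rfl | rfl | rfl
          · exact hxD this
          · exact hxD (dimg_rot hp this)
          · exact hxD (dimg_rot hp (dimg_rot hp this))
    · obtain ⟨t, ht, htS, hrt⟩ := ih hz hzD hzS
      refine ⟨t, ht, htS, Relation.ReflTransGen.head ⟨hxF,
        mem_newF.2 (Or.inl ⟨z, hz, hzD, rfl⟩), hxS', ?_, ?_⟩ hrt⟩
      · rw [sp_mp]; exact Finset.image_subset_image hzS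
      · rw [sp_mp, sp_mp, ← Finset.image_inter _ _ G.hj, Finset.card_image_of_injective _ G.hj]
        exact hcard

lemma conn_bd (hp : Piece β D P) (G : Glue j ι κ β)
    (hr : ∀ a b c, (a, b, c) ∈ A → (b, c, a) ∈ A)
    (hu : ∀ a b c c', (a, b, c) ∈ A → (a, b, c') ∈ A → c = c')
    (hD : ∀ d ∈ D, mp κ d ∈ A) (S : Finset B) (hS : S.card ≤ 1) (hc : Conn A (S.image κ))
    (hcP : Conn P (S.image β)) : Conn (newF j ι κ A D P) ((S.image κ).image j) := by
  have eS : (S.image κ).image j = (S.image β).image ι := by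
    rw [Finset.image_image, Finset.image_image]
    exact Finset.image_congr (fun b _ => (G.comm b).symm)
  have key : ∀ x ∈ newF j ι κ A D P, (S.image κ).image j ⊆ sp x → ∃ t ∈ P, S.image β ⊆ sp t ∧
      Relation.ReflTransGen (Rel (newF j ι κ A D P) ((S.image κ).image j)) x (mp ι t) := by
    intro x hx hxS
    rcases mem_newF.1 hx with ⟨y, hy, hyD, rfl⟩ | ⟨y, hy, rfl⟩
    · refine attach hp G hr hu hD S hS hc y hy hyD ?_
      rw [sp_mp] at hxS
      exact (Finset.image_subset_image_iff G.hj).1 hxS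
    · refine ⟨y, hy, ?_, .refl⟩
      rw [eS, sp_mp] at hxS
      exact (Finset.image_subset_image_iff G.hι).1 hxS
  intro x hx y hy hxS hyS
  obtain ⟨s, hs, hsS, h1⟩ := key x hx hxS
  obtain ⟨t, ht, htS, h2⟩ := key y hy hyS
  have h3 := rtg_lift (G := newF j ι κ A D P) G.hι
    (fun z hz _ => mem_newF.2 (Or.inr ⟨z, hz, rfl⟩)) (hcP s hs t ht hsS htS)
  rw [← eS] at h3
  exact h1.trans (h3.trans (rtg_symm h2))

lemma conn_vert (hp : Piece β D P) (G : Glue j ι κ β)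
    (hr : ∀ a b c, (a, b, c) ∈ A → (b, c, a) ∈ A)
    (hu : ∀ a b c c', (a, b, c) ∈ A → (a, b, c') ∈ A → c = c')
    (hD : ∀ d ∈ D, mp κ d ∈ A) (hc : ∀ v, Conn A {v}) (w : W) :
    Conn (newF j ι κ A D P) {w} := by
  by_cases hw : ∃ b, w = j (κ b)
  · obtain ⟨b, rfl⟩ := hw
    have := conn_bd hp G hr hu hD {b} (by simp) (by simpa using hc (κ b))
      (by simpa using hp.conn1 (β b))
    simpa using this
  rcases G.cov w with ⟨v, rfl⟩ | ⟨u, rfl⟩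
  · have key : ∀ x ∈ newF j ι κ A D P, {j v} ⊆ sp x →
        ∃ y ∈ A, {v} ⊆ sp y ∧ x = mp j y := by
      intro x hx hxS
      rcases mem_newF.1 hx with ⟨y, hy, hyD, rfl⟩ | ⟨y, hy, rfl⟩
      · refine ⟨y, hy, ?_, rfl⟩
        rw [sp_mp, ← Finset.image_singleton] at hxS
        exact (Finset.image_subset_image_iff G.hj).1 hxS
      · exfalso
        rw [sp_mp, Finset.singleton_subset_iff, Finset.mem_image] at hxS
        obtain ⟨u, _, hu'⟩ := hxS
        obtain ⟨b, rfl, _⟩ := G.ovl _ _ hu'.symm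
        exact hw ⟨b, rfl⟩
    intro x hx y hy hxS hyS
    obtain ⟨x', hx', hxS', rfl⟩ := key x hx hxS
    obtain ⟨y', hy', hyS', rfl⟩ := key y hy hyS
    rw [← Finset.image_singleton]
    refine rtg_lift G.hj ?_ (hc v x' hx' y' hy' hxS' hyS')
    intro z hz hzS
    refine mem_newF.2 (Or.inl ⟨z, hz, ?_, rfl⟩)
    intro hzD
    obtain ⟨d, _, rfl⟩ := Finset.mem_image.1 hzD
    rw [sp_mp, Finset.singleton_subset_iff, Finset.mem_image] at hzS
    obtain ⟨b, _, rfl⟩ := hzS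
    exact hw ⟨b, rfl⟩
  · have key : ∀ x ∈ newF j ι κ A D P, {ι u} ⊆ sp x →
        ∃ y ∈ P, {u} ⊆ sp y ∧ x = mp ι y := by
      intro x hx hxS
      rcases mem_newF.1 hx with ⟨y, hy, hyD, rfl⟩ | ⟨y, hy, rfl⟩
      · exfalso
        rw [sp_mp, Finset.singleton_subset_iff, Finset.mem_image] at hxS
        obtain ⟨v, _, hv⟩ := hxS
        obtain ⟨b, _, rfl⟩ := G.ovl _ _ hv
        exact hw ⟨b, G.comm b⟩
      · refine ⟨y, hy, ?_, rfl⟩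
        rw [sp_mp, ← Finset.image_singleton] at hxS
        exact (Finset.image_subset_image_iff G.hι).1 hxS
    intro x hx y hy hxS hyS
    obtain ⟨x', hx', hxS', rfl⟩ := key x hx hxS
    obtain ⟨y', hy', hyS', rfl⟩ := key y hy hyS
    rw [← Finset.image_singleton]
    exact rtg_lift G.hι (fun z hz _ => mem_newF.2 (Or.inr ⟨z, hz, rfl⟩))
      (hp.conn1 u x' hx' y' hy' hxS' hyS')

/-- The surface after the surgery. -/
theorem surgery [Fintype V] [Fintype W] (hp : Piece β D P) (G : Glue j ι κ β) (K : OSurf V)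
    (hanti : ∀ a b c, (a, b, c) ∈ K.F → (b, a, c) ∉ K.F)
    (hD : ∀ d ∈ D, mp κ d ∈ K.F) :
    ∃ K' : OSurf W, K'.F = newF j ι κ K.F D P ∧
      ∀ a b c, (a, b, c) ∈ K'.F → (b, a, c) ∉ K'.F := by
  have hr := K.rot_mem
  have hu := K.dart_unique
  have mixed : ∀ x ∈ K.F, x ∉ D.image (mp κ) → ∀ y ∈ P, j x.1 = ι y.1 → j x.2.1 = ι y.2.1 →
      False := by
    rintro ⟨a, b, c⟩ hx hxD y hy h1 h2
    obtain ⟨s, rfl, hs⟩ := G.ovl _ _ h1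
    obtain ⟨t, rfl, ht⟩ := G.ovl _ _ h2
    exact hxD (in_dimg hu hD hx (hp.inner y hy s t hs ht))
  have mixedAnti : ∀ x ∈ K.F, ∀ y ∈ P, j x.1 = ι y.2.1 → j x.2.1 = ι y.1 →
      j x.2.2 = ι y.2.2 → False := by
    rintro ⟨a, b, c⟩ hx y hy h1 h2 h3
    obtain ⟨s, rfl, hs⟩ := G.ovl _ _ h1
    obtain ⟨t, rfl, ht⟩ := G.ovl _ _ h2
    obtain ⟨u, rfl, hu⟩ := G.ovl _ _ h3
    exact hanti _ _ _ hx (hD _ (hp.full y hy t s u ht hs hu))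
  have c0 : Conn K.F ∅ := by
    intro x hx y hy _ _
    refine rtg_map id ?_ (K.connected x hx y hy)
    rintro s t ⟨h1, h2, h3⟩
    exact ⟨h1, h2, by simp, by simp, h3⟩
  have c1 : ∀ v, Conn K.F {v} := by
    intro v x hx y hy hxv hyv
    refine rtg_map id ?_ (K.link_connected v x hx y hy
      (Finset.singleton_subset_iff.1 hxv) (Finset.singleton_subset_iff.1 hyv))
    rintro s t ⟨h1, h2, h3, h4, h5⟩
    exact ⟨h1, h2, Finset.singleton_subset_iff.2 h3, Finset.singleton_subset_iff.2 h4, h5⟩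
  refine ⟨{ F := newF j ι κ K.F D P
            rot_mem := ?_
            nondegen := ?_
            dart_unique := ?_
            dart_rev := ?_
            vertex_cover := ?_
            connected := ?_
            link_connected := ?_ }, rfl, ?_⟩
  · intro a b c h
    rcases mem_newF.1 h with ⟨⟨x, y, z⟩, hx, hxD, e⟩ | ⟨x, hx, e⟩
    · simp only [mp, Prod.mk.injEq] at e
      obtain ⟨rfl, rfl, rfl⟩ := e
      refine mem_newF.2 (Or.inl ⟨(y, z, x), hr _ _ _ hx, ?_, rfl⟩)
      intro h'
      exact hxD (dimg_rot hp (dimg_rot hp h'))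
    · simp only [mp, Prod.mk.injEq] at e
      obtain ⟨rfl, rfl, rfl⟩ := e
      exact mem_newF.2 (Or.inr ⟨_, hp.rot x hx, rfl⟩)
  · intro a b c h
    rcases mem_newF.1 h with ⟨⟨x, y, z⟩, hx, hxD, e⟩ | ⟨x, hx, e⟩
    · simp only [mp, Prod.mk.injEq] at e
      obtain ⟨rfl, rfl, rfl⟩ := e
      obtain ⟨h1, h2, h3⟩ := K.nondegen _ _ _ hx
      exact ⟨G.hj.ne h1, G.hj.ne h2, G.hj.ne h3⟩
    · simp only [mp, Prod.mk.injEq] at e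
      obtain ⟨rfl, rfl, rfl⟩ := e
      obtain ⟨h1, h2, h3⟩ := hp.nondeg _ hx
      exact ⟨G.hι.ne h1, G.hι.ne h2, G.hι.ne h3⟩
  · intro a b c c' h h'
    rcases mem_newF.1 h with ⟨⟨x, y, z⟩, hx, hxD, e⟩ | ⟨x, hx, e⟩ <;>
      rcases mem_newF.1 h' with ⟨⟨x', y', z'⟩, hx', hxD', e'⟩ | ⟨x', hx', e'⟩ <;>
      simp only [mp, Prod.mk.injEq] at e e'
    · obtain ⟨rfl, rfl, rfl⟩ := e
      obtain ⟨h1, h2, rfl⟩ := e'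
      obtain rfl := G.hj h1
      obtain rfl := G.hj h2
      rw [hu _ _ _ _ hx hx']
    · exact (mixed _ hx hxD _ hx' (e.1.symm.trans e'.1) (e.2.1.symm.trans e'.2.1)).elim
    · exact (mixed _ hx' hxD' _ hx (e'.1.symm.trans e.1) (e'.2.1.symm.trans e.2.1)).elim
    · rw [e.2.2, e'.2.2]
      congr 1
      exact hp.uniq _ hx _ hx' (G.hι (e.1.symm.trans e'.1)) (G.hι (e.2.1.symm.trans e'.2.1))
  · intro a b c h
    rcases mem_newF.1 h with ⟨⟨x, y, z⟩, hx, hxD, e⟩ | ⟨x, hx, e⟩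
    · simp only [mp, Prod.mk.injEq] at e
      obtain ⟨rfl, rfl, rfl⟩ := e
      obtain ⟨z', hz'⟩ := K.dart_rev _ _ _ hx
      by_cases hD' : (y, x, z') ∈ D.image (mp κ)
      · obtain ⟨d, hd, e⟩ := Finset.mem_image.1 hD'
        simp only [mp, Prod.mk.injEq] at e
        obtain ⟨rfl, rfl, rfl⟩ := e
        rcases hp.drev d hd with h1 | ⟨u, h1⟩
        · exact absurd (in_dimg hu hD hx h1) hxD
        · refine ⟨ι u, mem_newF.2 (Or.inr ⟨_, h1, ?_⟩)⟩
          simp [mp, G.comm]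
      · exact ⟨j z', mem_newF.2 (Or.inl ⟨_, hz', hD', rfl⟩)⟩
    · simp only [mp, Prod.mk.injEq] at e
      obtain ⟨rfl, rfl, rfl⟩ := e
      rcases hp.rev x hx with ⟨u, h1⟩ | ⟨s, t, hs, ht, ⟨u, h1⟩, h2⟩
      · exact ⟨ι u, mem_newF.2 (Or.inr ⟨_, h1, rfl⟩)⟩
      · obtain ⟨z, hz⟩ := K.dart_rev _ _ _ (hD _ h1)
        refine ⟨j z, mem_newF.2 (Or.inl ⟨_, hz, ?_, ?_⟩)⟩
        · intro h'
          obtain ⟨⟨p, q, r⟩, hd, e⟩ := Finset.mem_image.1 h'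
          simp only [mp, Prod.mk.injEq] at e
          obtain rfl := G.hκ e.1
          obtain rfl := G.hκ e.2.1
          exact h2 _ hd
        · simp [mp, hs, ht, G.comm]
  · intro w
    by_cases hw : ∃ u, w = ι u
    · obtain ⟨u, rfl⟩ := hw
      obtain ⟨b, c, h⟩ := hp.cover u
      exact ⟨ι b, ι c, mem_newF.2 (Or.inr ⟨_, h, rfl⟩)⟩
    · obtain ⟨v, rfl⟩ := (G.cov w).resolve_right hw
      obtain ⟨b, c, h⟩ := K.vertex_cover v
      refine ⟨j b, j c, mem_newF.2 (Or.inl ⟨_, h, ?_, rfl⟩)⟩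
      intro h'
      obtain ⟨d, hd, e⟩ := Finset.mem_image.1 h'
      simp only [mp, Prod.mk.injEq] at e
      obtain ⟨rfl, _, _⟩ := e
      exact hw ⟨β d.1, (G.comm _).symm⟩
  · have := conn_bd hp G hr hu hD ∅ (by simp) (by simpa using c0) (by simpa using hp.conn0)
    intro x hx y hy
    refine rtg_map id ?_ (this x hx y hy (by simp) (by simp))
    rintro s t ⟨h1, h2, _, _, h3⟩
    exact ⟨h1, h2, h3⟩
  · intro v x hx y hy hxv hyv
    have := conn_vert hp G hr hu hD c1 v
    refine rtg_map id ?_ (this x hx y hy (Finset.singleton_subset_iff.2 hxv)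
      (Finset.singleton_subset_iff.2 hyv))
    rintro s t ⟨h1, h2, h3, h4, h5⟩
    exact ⟨h1, h2, Finset.singleton_subset_iff.1 h3, Finset.singleton_subset_iff.1 h4, h5⟩
  · intro a b c h h'
    rcases mem_newF.1 h with ⟨⟨x, y, z⟩, hx, hxD, e⟩ | ⟨x, hx, e⟩ <;>
      rcases mem_newF.1 h' with ⟨⟨x', y', z'⟩, hx', hxD', e'⟩ | ⟨x', hx', e'⟩ <;>
      simp only [mp, Prod.mk.injEq] at e e'
    · obtain ⟨rfl, rfl, rfl⟩ := e
      obtain ⟨h1, h2, h3⟩ := e'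
      obtain rfl := G.hj h1
      obtain rfl := G.hj h2
      obtain rfl := G.hj h3
      exact hanti _ _ _ hx hx'
    · exact mixedAnti _ hx _ hx' (e.1.symm.trans e'.2.1) (e.2.1.symm.trans e'.1)
        (e.2.2.symm.trans e'.2.2)
    · exact mixedAnti _ hx' _ hx (e'.1.symm.trans e.2.1) (e'.2.1.symm.trans e.1)
        (e'.2.2.symm.trans e.2.2)
    · obtain ⟨p, q, r⟩ := x
      obtain ⟨p', q', r'⟩ := x'
      obtain rfl := G.hι (e.1.symm.trans e'.2.1)
      obtain rfl := G.hι (e.2.1.symm.trans e'.1)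
      obtain rfl := G.hι (e.2.2.symm.trans e'.2.2)
      exact (hp.anti _ hx hx').elim

/-- Counting over the new facets. -/
lemma card_filter_newF (hp : Piece β D P) (G : Glue j ι κ β)
    (hu : ∀ a b c c', (a, b, c) ∈ A → (a, b, c') ∈ A → c = c')
    (hD : ∀ d ∈ D, mp κ d ∈ A) (p : W × W × W → Prop) [DecidablePred p] :
    ((newF j ι κ A D P).filter p).card + (D.filter fun d => p (mp j (mp κ d))).card =
      (A.filter fun x => p (mp j x)).card + (P.filter fun x => p (mp ι x)).card := by
  have hdis : Disjoint ((A \ D.image (mp κ)).image (mp j)) (P.image (mp ι)) := by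
    rw [Finset.disjoint_left]
    intro w h1 h2
    obtain ⟨⟨a, b, c⟩, hx, rfl⟩ := Finset.mem_image.1 h1
    obtain ⟨y, hy, e⟩ := Finset.mem_image.1 h2
    simp only [mp, Prod.mk.injEq] at e
    rw [Finset.mem_sdiff] at hx
    obtain ⟨s, rfl, hs⟩ := G.ovl _ _ e.1.symm
    obtain ⟨t, rfl, ht⟩ := G.ovl _ _ e.2.1.symm
    exact hx.2 (in_dimg hu hD hx.1 (hp.inner y hy s t hs ht))
  have hsub : D.image (mp κ) ⊆ A := by
    intro x hx
    obtain ⟨d, hd, rfl⟩ := Finset.mem_image.1 hx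
    exact hD d hd
  rw [newF, Finset.filter_union, Finset.card_union_of_disjoint
    (Finset.disjoint_filter_filter hdis), Finset.filter_image, Finset.filter_image,
    Finset.card_image_of_injective _ (mp_inj G.hj), Finset.card_image_of_injective _ (mp_inj G.hι)]
  have e1 : (D.filter fun d => p (mp j (mp κ d))).card =
      ((D.image (mp κ)).filter fun x => p (mp j x)).card := by
    rw [Finset.filter_image, Finset.card_image_of_injective _ (mp_inj G.hκ)]
  have e2 : (A.filter fun x => p (mp j x)).card =
      ((A \ D.image (mp κ)).filter fun x => p (mp j x)).card +
      ((D.image (mp κ)).filter fun x => p (mp j x)).card := by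
    rw [← Finset.card_union_of_disjoint (Finset.disjoint_filter_filter Finset.sdiff_disjoint),
      ← Finset.filter_union, Finset.sdiff_union_of_subset hsub]
  omega

end surgery

end Surg
namespace Surg

section euler
variable {V : Type} [DecidableEq V] [Fintype V]

lemma card_faces (K : OSurf V) (hanti : ∀ a b c, (a, b, c) ∈ K.F → (b, a, c) ∉ K.F) :
    K.F.card = 3 * K.faces.card := by
  rw [Finset.card_eq_sum_card_image (fun x : V × V × V => ({x.1, x.2.1, x.2.2} : Finset V)) K.F]
  change ∑ t ∈ K.faces, _ = _
  rw [Finset.sum_const_nat (m := 3), mul_comm]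
  intro t ht
  obtain ⟨⟨a, b, c⟩, hx, rfl⟩ := Finset.mem_image.1 ht
  obtain ⟨hab, hbc, hac⟩ := K.nondegen _ _ _ hx
  have h1 := K.rot_mem _ _ _ hx
  have h2 := K.rot_mem _ _ _ h1
  rw [Finset.card_eq_three]
  refine ⟨(a, b, c), (b, c, a), (c, a, b), by simp [hab], by simp [hac], by simp [hbc], ?_⟩
  ext x
  simp only [Finset.mem_filter, Finset.mem_insert, Finset.mem_singleton]
  constructor
  · rintro ⟨hy, e⟩
    have hy' := K.rot_mem _ _ _ hy
    have ha : a ∈ sp x := by change a ∈ ({x.1, x.2.1, x.2.2} : Finset V); rw [e]; simp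
    have hb : b ∈ sp x := by change b ∈ ({x.1, x.2.1, x.2.2} : Finset V); rw [e]; simp
    obtain ⟨d, ⟨hd, hs, h⟩ | ⟨hd, hs, h⟩⟩ := two_mem K.rot_mem hy hab ha hb
    · obtain rfl := K.dart_unique _ _ _ _ hx hd
      exact h
    · exfalso
      have hc : c ∈ sp (b, a, d) := by
        rw [hs]; change c ∈ ({x.1, x.2.1, x.2.2} : Finset V); rw [e]; simp
      simp only [sp, Finset.mem_insert, Finset.mem_singleton] at hc
      rcases hc with h | h | h
      · exact hbc h.symm
      · exact hac h.symm
      · subst h; exact hanti _ _ _ hx hd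
  · rintro (rfl | rfl | rfl)
    · exact ⟨hx, rfl⟩
    · refine ⟨h1, ?_⟩
      ext; simp; tauto
    · refine ⟨h2, ?_⟩
      ext; simp; tauto

lemma edges_eq (K : OSurf V) :
    K.edges = K.F.image (fun x : V × V × V => ({x.1, x.2.1} : Finset V)) := by
  ext e
  simp only [OSurf.edges, OSurf.faces, Finset.mem_biUnion, Finset.mem_image,
    Finset.mem_powersetCard]
  constructor
  · rintro ⟨_, ⟨x, hx, rfl⟩, h1, h2⟩
    obtain ⟨a, b, hab, rfl⟩ := Finset.card_eq_two.1 h2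
    have ha : a ∈ sp x := h1 (by simp)
    have hb : b ∈ sp x := h1 (by simp)
    obtain ⟨d, ⟨hd, _, _⟩ | ⟨hd, _, _⟩⟩ := two_mem K.rot_mem hx hab ha hb
    · exact ⟨_, hd, rfl⟩
    · exact ⟨_, hd, Finset.pair_comm _ _⟩
  · rintro ⟨⟨a, b, c⟩, hx, rfl⟩
    refine ⟨_, ⟨_, hx, rfl⟩, ?_, Finset.card_pair (K.nondegen _ _ _ hx).1⟩
    intro y; simp; tauto

lemma card_edges (K : OSurf V) : K.F.card = 2 * K.edges.card := by
  rw [Finset.card_eq_sum_card_image (fun x : V × V × V => ({x.1, x.2.1} : Finset V)) K.F,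
    ← edges_eq, Finset.sum_const_nat (m := 2), mul_comm]
  intro t ht
  rw [edges_eq] at ht
  obtain ⟨⟨a, b, c⟩, hx, rfl⟩ := Finset.mem_image.1 ht
  obtain ⟨hab, hbc, hac⟩ := K.nondegen _ _ _ hx
  obtain ⟨d, hd⟩ := K.dart_rev _ _ _ hx
  rw [Finset.card_eq_two]
  refine ⟨(a, b, c), (b, a, d), by simp [hab], ?_⟩
  ext ⟨p, q, r⟩
  simp only [Finset.mem_filter, Finset.mem_insert, Finset.mem_singleton]
  constructor
  · rintro ⟨hy, e⟩
    have hpq := (K.nondegen _ _ _ hy).1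
    have hp : p ∈ ({a, b} : Finset V) := by rw [← e]; simp
    have hq : q ∈ ({a, b} : Finset V) := by rw [← e]; simp
    simp only [Finset.mem_insert, Finset.mem_singleton] at hp hq
    rcases hp with rfl | rfl <;> rcases hq with rfl | rfl
    · exact absurd rfl hpq
    · left; rw [K.dart_unique _ _ _ _ hx hy]
    · right; rw [K.dart_unique _ _ _ _ hd hy]
    · exact absurd rfl hpq
  · rintro (h | h) <;> simp only [Prod.mk.injEq] at h <;> obtain ⟨rfl, rfl, rfl⟩ := h
    · exact ⟨hx, rfl⟩
    · exact ⟨hd, Finset.pair_comm _ _⟩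

lemma genus_of_card (K : OSurf V) (hanti : ∀ a b c, (a, b, c) ∈ K.F → (b, a, c) ∉ K.F) (g : ℕ)
    (h : 6 * (Fintype.card V : ℤ) - K.F.card = 12 - 12 * g) : K.genusIs g := by
  have h1 := card_faces K hanti
  have h2 := card_edges K
  unfold OSurf.genusIs
  omega

end euler

/-- Facets of a rotation system. -/
def ofLk {N : ℕ} (lk : Fin N → List (Fin N)) : Finset (Fin N × Fin N × Fin N) :=
  Finset.univ.biUnion fun v => (((lk v).zip (lk v).tail).map fun p => (v, p)).toFinset

lemma mem_ofLk {N : ℕ} {lk : Fin N → List (Fin N)} {v b c : Fin N} :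
    (v, b, c) ∈ ofLk lk ↔ (b, c) ∈ (lk v).zip (lk v).tail := by
  simp [ofLk]

lemma chain_conn {V : Type} [DecidableEq V] {P : Finset (V × V × V)}
    (hn : ∀ x ∈ P, x.1 ≠ x.2.1 ∧ x.2.1 ≠ x.2.2 ∧ x.1 ≠ x.2.2) (v : V) :
    ∀ (l : List V) (w0 w1 : V),
      (∀ p ∈ (w0 :: w1 :: l).zip (w1 :: l), (v, p.1, p.2) ∈ P) →
      ∀ p ∈ (w0 :: w1 :: l).zip (w1 :: l),
        Relation.ReflTransGen (Rel P {v}) (v, w0, w1) (v, p.1, p.2) := by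
  intro l
  induction l with
  | nil =>
    intro w0 w1 _ p hp
    simp at hp
    subst hp
    exact .refl
  | cons w2 l ih =>
    intro w0 w1 h p hp
    rw [List.zip_cons_cons, List.mem_cons] at hp
    rcases hp with rfl | hp
    · exact .refl
    · refine .head ?_ (ih w1 w2 (fun q hq => h q (by
        rw [List.zip_cons_cons]; exact List.mem_cons_of_mem _ hq)) p hp)
      have a1 := h (w0, w1) (by simp)
      have a2 := h (w1, w2) (by simp)
      refine ⟨a1, a2, by simp [sp], by simp [sp], ?_⟩
      exact two_le_inter (a := v) (b := w1) (hn _ a2).1 (by simp [sp]) (by simp [sp])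
        (by simp [sp]) (by simp [sp])

lemma conn1_ofLk {N : ℕ} {lk : Fin N → List (Fin N)}
    (hr : ∀ x ∈ ofLk lk, (x.2.1, x.2.2, x.1) ∈ ofLk lk)
    (hn : ∀ x ∈ ofLk lk, x.1 ≠ x.2.1 ∧ x.2.1 ≠ x.2.2 ∧ x.1 ≠ x.2.2) (v : Fin N) :
    Conn (ofLk lk) {v} := by
  have key : ∀ x ∈ ofLk lk, {v} ⊆ sp x → ∃ b c, (v, b, c) ∈ ofLk lk ∧
      Relation.ReflTransGen (Rel (ofLk lk) {v}) x (v, b, c) := by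
    rintro ⟨p, q, r⟩ hx hv
    have h1 := hr _ hx
    have h2 := hr _ h1
    have hc : (sp (p, q, r)).card = 3 := by
      obtain ⟨ha, hb, hc⟩ := hn _ hx
      exact Finset.card_eq_three.2 ⟨p, q, r, ha, hc, hb, rfl⟩
    have e1 : sp (q, r, p) = sp (p, q, r) := by ext; simp [sp]; tauto
    have e2 : sp (r, p, q) = sp (p, q, r) := by ext; simp [sp]; tauto
    have hv' := hv
    simp only [sp, Finset.singleton_subset_iff, Finset.mem_insert, Finset.mem_singleton] at hv'
    rcases hv' with rfl | rfl | rfl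
    · exact ⟨_, _, hx, .refl⟩
    · exact ⟨_, _, h1, .single ⟨hx, h1, hv, e1 ▸ hv, by rw [e1, Finset.inter_self]; omega⟩⟩
    · exact ⟨_, _, h2, .single ⟨hx, h2, hv, e2 ▸ hv, by rw [e2, Finset.inter_self]; omega⟩⟩
  intro x hx y hy hxv hyv
  obtain ⟨b, c, hbc, h1⟩ := key x hx hxv
  obtain ⟨b', c', hbc', h2⟩ := key y hy hyv
  have m1 := mem_ofLk.1 hbc
  have m2 := mem_ofLk.1 hbc'
  have hall : ∀ p ∈ (lk v).zip (lk v).tail, (v, p.1, p.2) ∈ ofLk lk := fun p hp =>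
    mem_ofLk.2 hp
  match hl : lk v with
  | [] => rw [hl] at m1; simp at m1
  | [_] => rw [hl] at m1; simp at m1
  | w0 :: w1 :: l =>
    rw [hl] at m1 m2 hall
    have k1 := chain_conn hn v l w0 w1 hall _ m1
    have k2 := chain_conn hn v l w0 w1 hall _ m2
    exact h1.trans ((rtg_symm k1).trans (k2.trans (rtg_symm h2)))

lemma conn0_of_conn1 {N : ℕ} [NeZero N] {P : Finset (Fin N × Fin N × Fin N)}
    (h1 : ∀ v, Conn P {v})
    (hpar : ∀ v : Fin N, v ≠ 0 → ∃ x ∈ P, v = x.1 ∧ (x.2.1 < v ∨ x.2.2 < v)) :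
    Conn P ∅ := by
  have up : ∀ {v x y}, Relation.ReflTransGen (Rel P {v}) x y →
      Relation.ReflTransGen (Rel P ∅) x y := fun h =>
    rtg_map id (fun s t ⟨a, b, _, _, c⟩ => ⟨a, b, by simp, by simp, c⟩) h
  have key : ∀ n : ℕ, ∀ v : Fin N, v.val = n → ∀ x ∈ P, v ∈ sp x → ∃ y ∈ P, 0 ∈ sp y ∧
      Relation.ReflTransGen (Rel P ∅) x y := by
    intro n
    induction n using Nat.strong_induction_on with
    | _ n ih =>
      intro v hv x hx hvx
      by_cases h0 : v = 0
      · subst h0; exact ⟨x, hx, hvx, .refl⟩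
      obtain ⟨z, hz, hvz, hlt⟩ := hpar v h0
      have hvz' : v ∈ sp z := by simp [sp, hvz]
      have hxz := up (h1 v x hx z hz (by simpa using hvx) (by simpa using hvz'))
      obtain ⟨u, hu, huz⟩ : ∃ u, u < v ∧ u ∈ sp z := by
        rcases hlt with h | h
        · exact ⟨_, h, by simp [sp]⟩
        · exact ⟨_, h, by simp [sp]⟩
      obtain ⟨y, hy, h0y, hzy⟩ := ih u.val (by rw [← hv]; exact hu) u rfl z hz huz
      exact ⟨y, hy, h0y, hxz.trans hzy⟩
  intro x hx y hy _ _
  obtain ⟨a, ha, ha0, hxa⟩ := key _ x.1 rfl x hx (by simp [sp])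
  obtain ⟨b, hb, hb0, hyb⟩ := key _ y.1 rfl y hy (by simp [sp])
  exact hxa.trans ((up (h1 0 a ha b hb (by simpa using ha0) (by simpa using hb0))).trans
    (rtg_symm hyb))

/-- The removed disc: two adjacent facets. -/
def D4 : Finset (Fin 4 × Fin 4 × Fin 4) :=
  {(0, 1, 3), (1, 3, 0), (3, 0, 1), (1, 2, 3), (2, 3, 1), (3, 1, 2)}

/-- Labels of the disc. -/
def lab4 : Fin 4 → Fin 7 := ![1, 2, 5, 4]

/-- Rotation system of the patch of degree one. -/
def lk1 : Fin (4 + 6) → List (Fin (4 + 6)) :=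
  fun v => List.getD [[1, 6, 4, 3],
    [2, 3, 4, 8, 9, 5, 7, 6, 0],
    [3, 1],
    [0, 4, 1, 2],
    [7, 8, 1, 3, 0, 6, 5, 9, 7],
    [7, 1, 9, 4, 6, 8, 7],
    [8, 5, 4, 0, 1, 7, 9, 8],
    [1, 5, 8, 4, 9, 6, 1],
    [5, 6, 9, 1, 4, 7, 5],
    [6, 7, 4, 5, 1, 8, 6]] v.val []

def ps1 : Fin (4 + 6) → Fin 7 := fun v => List.getD [1, 2, 5, 4, 1, 3, 4, 5, 6, 0] v.val 0

/-- Rotation system of the patch of degree two. -/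
def lk2 : Fin (4 + 12) → List (Fin (4 + 12)) :=
  fun v => List.getD [[1, 11, 9, 5, 13, 15, 4, 3],
    [2, 11, 0],
    [3, 4, 9, 14, 7, 6, 11, 1],
    [0, 4, 2],
    [15, 5, 9, 2, 3, 0, 15],
    [4, 15, 12, 13, 0, 9, 4],
    [2, 7, 10, 8, 14, 11, 2],
    [12, 10, 6, 2, 14, 8, 12],
    [13, 12, 7, 14, 6, 10, 13],
    [11, 14, 2, 4, 5, 0, 11],
    [7, 12, 15, 13, 8, 6, 7],
    [2, 6, 14, 9, 0, 1, 2],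
    [10, 7, 8, 13, 5, 15, 10],
    [12, 8, 10, 15, 0, 5, 12],
    [8, 7, 2, 9, 11, 6, 8],
    [5, 4, 0, 13, 10, 12, 5]] v.val []

def ps2 : Fin (4 + 12) → Fin 7 := fun v => List.getD [1, 2, 5, 4, 2, 0, 0, 1, 2, 3, 3, 4, 4, 5, 6, 6] v.val 0

/-- Everything needed of a patch with `k` new vertices and degree `e`. -/
structure Good (k e : ℕ) (P : Finset (Fin (4 + k) × Fin (4 + k) × Fin (4 + k)))
    (ps : Fin (4 + k) → Fin 7) : Prop where
  piece : Piece (Fin.castAdd k) D4 P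
  card : P.card = 6 * k + 18
  lab : ∀ b, ps (Fin.castAdd k b) = lab4 b
  smp : ∀ x ∈ P, ∃ t ∈ torusF, ({ps x.1, ps x.2.1, ps x.2.2} : Finset (Fin 7)) ⊆ sp t
  deg : ∀ t ∈ torusF,
    ((P.filter fun x => mp ps x = t).card + (D4.filter fun x => mp lab4 x = (t.1, t.2.2, t.2.1)).card)
    = e + (P.filter fun x => mp ps x = (t.1, t.2.2, t.2.1)).card +
      (D4.filter fun x => mp lab4 x = t).card
  nxt : ∃ κ : Fin 4 → Fin (4 + k), Function.Injective κ ∧ (∀ d ∈ D4, mp κ d ∈ P) ∧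
    ∀ b, ps (κ b) = lab4 b

end Surg

namespace Surg

/-- Consecutive pairs in a link. -/
def zl {N : ℕ} (lk : Fin N → List (Fin N)) (v : Fin N) : List (Fin N × Fin N) :=
  (lk v).zip (lk v).tail

lemma mem_ofLk' {N : ℕ} {lk : Fin N → List (Fin N)} {v b c : Fin N} :
    (v, b, c) ∈ ofLk lk ↔ (b, c) ∈ zl lk v := mem_ofLk

lemma forall_ofLk {N : ℕ} {lk : Fin N → List (Fin N)} {Q : Fin N × Fin N × Fin N → Prop} :
    (∀ x ∈ ofLk lk, Q x) ↔ ∀ v, ∀ p ∈ zl lk v, Q (v, p) := by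
  constructor
  · exact fun h v p hp => h _ (mem_ofLk'.2 hp)
  · rintro h ⟨v, b, c⟩ hx
    exact h _ _ (mem_ofLk'.1 hx)

lemma exists_ofLk {N : ℕ} {lk : Fin N → List (Fin N)} {Q : Fin N × Fin N × Fin N → Prop} :
    (∃ x ∈ ofLk lk, Q x) ↔ ∃ v, ∃ p ∈ zl lk v, Q (v, p) := by
  constructor
  · rintro ⟨⟨v, b, c⟩, hx, h⟩
    exact ⟨_, _, mem_ofLk'.1 hx, h⟩
  · rintro ⟨v, p, hp, h⟩
    exact ⟨_, mem_ofLk'.2 hp, h⟩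

lemma exists_snd {N : ℕ} {lk : Fin N → List (Fin N)} {v b : Fin N} :
    (∃ c, (b, c) ∈ zl lk v) ↔ ∃ p ∈ zl lk v, p.1 = b := by
  constructor
  · rintro ⟨c, h⟩
    exact ⟨_, h, rfl⟩
  · rintro ⟨⟨_, c⟩, h, rfl⟩
    exact ⟨c, h⟩

lemma uniq_ofLk {N : ℕ} {lk : Fin N → List (Fin N)}
    (h : ∀ v, ∀ p ∈ zl lk v, ∀ q ∈ zl lk v, p.1 = q.1 → p.2 = q.2) :
    ∀ x ∈ ofLk lk, ∀ y ∈ ofLk lk, x.1 = y.1 → x.2.1 = y.2.1 → x.2.2 = y.2.2 := by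
  rintro ⟨v, b, c⟩ hx ⟨v', b', c'⟩ hy rfl h2
  exact h v _ (mem_ofLk'.1 hx) _ (mem_ofLk'.1 hy) h2

lemma cover_ofLk {N : ℕ} {lk : Fin N → List (Fin N)} (h : ∀ v, zl lk v ≠ []) :
    ∀ v, ∃ b c, (v, b, c) ∈ ofLk lk := by
  intro v
  obtain ⟨p, hp⟩ := List.exists_mem_of_ne_nil _ (h v)
  exact ⟨p.1, p.2, mem_ofLk'.2 hp⟩

/-- Counting facets of a rotation system. -/
lemma count_ofLk {N : ℕ} {lk : Fin N → List (Fin N)} (hd : ∀ v, (zl lk v).Nodup)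
    (Q : Fin N × Fin N × Fin N → Prop) [DecidablePred Q] :
    ((ofLk lk).filter Q).card =
      ((List.finRange N).map fun v => (zl lk v).countP fun p => decide (Q (v, p))).sum := by
  rw [ofLk, Finset.filter_biUnion, Finset.card_biUnion]
  · rw [← List.sum_toFinset _ (List.nodup_finRange N), List.toFinset_finRange]
    refine Finset.sum_congr rfl fun v _ => ?_
    have e : Finset.filter Q (((lk v).zip (lk v).tail).map fun p => (v, p)).toFinset =
        ((((lk v).zip (lk v).tail).map fun p => (v, p)).filter fun x => decide (Q x)).toFinset := by
      ext x
      simp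
    rw [e, List.toFinset_card_of_nodup, List.countP_eq_length_filter,
      List.filter_map, List.length_map]
    · rfl
    · refine List.Nodup.filter _ ((hd v).map ?_)
      intro a b h
      exact (Prod.mk.inj h).2
  · intro v _ w _ hvw
    rw [Function.onFun, Finset.disjoint_left]
    intro x h1 h2
    simp only [Finset.mem_filter, List.mem_toFinset, List.mem_map] at h1 h2
    obtain ⟨⟨p, _, rfl⟩, _⟩ := h1
    obtain ⟨⟨q, _, h⟩, _⟩ := h2
    exact hvw (Prod.mk.inj h).1.symm

lemma card_ofLk {N : ℕ} {lk : Fin N → List (Fin N)} (hd : ∀ v, (zl lk v).Nodup) :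
    (ofLk lk).card = ((List.finRange N).map fun v => (zl lk v).length).sum := by
  have := count_ofLk hd (fun _ => True)
  simpa using this

end Surg

namespace Surg

set_option synthInstance.maxHeartbeats 400000 in
set_option synthInstance.maxSize 2000 in
set_option maxRecDepth 100000 in
set_option maxHeartbeats 2000000 in
lemma good1 : Good 6 1 (ofLk lk1) ps1 := by
  have hr : ∀ x ∈ ofLk lk1, (x.2.1, x.2.2, x.1) ∈ ofLk lk1 := by
    simp only [forall_ofLk, mem_ofLk']; decide +kernel
  have hn : ∀ x ∈ ofLk lk1, x.1 ≠ x.2.1 ∧ x.2.1 ≠ x.2.2 ∧ x.1 ≠ x.2.2 := by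
    simp only [forall_ofLk]; decide +kernel
  have hc := conn1_ofLk hr hn
  have hd : ∀ v, (zl lk1 v).Nodup := by decide +kernel
  refine ⟨⟨?_, hr, hn, ?_, uniq_ofLk ?_, ?_, ?_, ?_, ?_, ?_, cover_ofLk ?_, ?_, ?_,
    conn0_of_conn1 hc ?_, hc⟩, (card_ofLk hd).trans ?_, ?_, ?_, ?_,
    ⟨![4, 1, 2, 3], ?_, ?_, ?_⟩⟩
  all_goals try simp only [forall_ofLk, exists_ofLk, mem_ofLk', exists_snd, count_ofLk hd]
  all_goals decide +kernel

set_option synthInstance.maxHeartbeats 400000 in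
set_option synthInstance.maxSize 2000 in
set_option maxRecDepth 100000 in
set_option maxHeartbeats 2000000 in
lemma good2 : Good 12 2 (ofLk lk2) ps2 := by
  have hr : ∀ x ∈ ofLk lk2, (x.2.1, x.2.2, x.1) ∈ ofLk lk2 := by
    simp only [forall_ofLk, mem_ofLk']; decide +kernel
  have hn : ∀ x ∈ ofLk lk2, x.1 ≠ x.2.1 ∧ x.2.1 ≠ x.2.2 ∧ x.1 ≠ x.2.2 := by
    simp only [forall_ofLk]; decide +kernel
  have hc := conn1_ofLk hr hn
  have hd : ∀ v, (zl lk2 v).Nodup := by decide +kernel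
  refine ⟨⟨?_, hr, hn, ?_, uniq_ofLk ?_, ?_, ?_, ?_, ?_, ?_, cover_ofLk ?_, ?_, ?_,
    conn0_of_conn1 hc ?_, hc⟩, (card_ofLk hd).trans ?_, ?_, ?_, ?_,
    ⟨![0, 4, 2, 3], ?_, ?_, ?_⟩⟩
  all_goals try simp only [forall_ofLk, exists_ofLk, mem_ofLk', exists_snd, count_ofLk hd]
  all_goals decide +kernel

end Surg

namespace Surg

/-- The inductive invariant. -/
def Inv (T : OSurf (Fin 7)) (n g d : ℕ) : Prop :=
  ∃ K : OSurf (Fin n), (∀ a b c, (a, b, c) ∈ K.F → (b, a, c) ∉ K.F) ∧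
    6 * (n : ℤ) - K.F.card = 12 - 12 * g ∧
    ∃ φ : Fin n → Fin 7, IsSimplicialMap K T φ ∧ HasDegree K T φ d ∧
      ∃ κ : Fin 4 → Fin n, Function.Injective κ ∧ (∀ x ∈ D4, mp κ x ∈ K.F) ∧
        ∀ b, φ (κ b) = lab4 b

lemma inv_base (T : OSurf (Fin 7)) (hT : T.F = torusF) : Inv T 7 1 1 := by
  refine ⟨T, ?_, ?_, id, ?_, ?_, lab4, ?_, ?_, fun b => rfl⟩
  · rw [hT]; decide +kernel
  · rw [hT]; decide +kernel
  · intro x hx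
    exact ⟨_, Finset.mem_image_of_mem _ hx, subset_rfl⟩
  · unfold HasDegree; rw [hT]; decide +kernel
  · decide +kernel
  · rw [hT]; decide +kernel

lemma inv_step (T : OSurf (Fin 7)) (hT : T.F = torusF) {k e n g d : ℕ} {P ps}
    (hG : Good k e P ps) (h : Inv T n g d) : Inv T (n + k) (g + 1) (d + e) := by
  obtain ⟨K, hanti, hcard, φ, hsim, hdeg, κ, hκ, hD, hlab⟩ := h
  let j : Fin n → Fin (n + k) := Fin.castAdd k
  let ι : Fin (4 + k) → Fin (n + k) :=
    Fin.addCases (fun b => Fin.castAdd k (κ b)) (fun x => Fin.natAdd n x)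
  let φ' : Fin (n + k) → Fin 7 := Fin.addCases φ (fun x => ps (Fin.natAdd 4 x))
  have ι1 : ∀ b, ι (Fin.castAdd k b) = Fin.castAdd k (κ b) := fun b => by simp [ι]
  have ι2 : ∀ x, ι (Fin.natAdd 4 x) = Fin.natAdd n x := fun b => by simp [ι]
  have ne : ∀ (a : Fin n) (b : Fin k), Fin.castAdd k a ≠ Fin.natAdd n b := by
    intro a b hab
    have := congrArg Fin.val hab
    simp at this
    omega
  have φj : ∀ v, φ' (j v) = φ v := fun v => by simp [φ', j]
  have φι : ∀ u, φ' (ι u) = ps u := by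
    intro u
    induction u using Fin.addCases with
    | left b => rw [ι1, hG.lab, ← hlab]; simp [φ']
    | right x => rw [ι2]; simp [φ']
  have G : Glue j ι κ (Fin.castAdd k) := by
    refine ⟨Fin.castAdd_injective _ _, ?_, hκ, ι1, ?_, ?_⟩
    · intro x y hxy
      induction x using Fin.addCases with
      | left b =>
        induction y using Fin.addCases with
        | left c =>
          rw [ι1, ι1] at hxy
          rw [hκ (Fin.castAdd_injective _ _ hxy)]
        | right c => rw [ι1, ι2] at hxy; exact absurd hxy (ne _ _)
      | right b =>
        induction y using Fin.addCases with
        | left c => rw [ι1, ι2] at hxy; exact absurd hxy.symm (ne _ _)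
        | right c =>
          rw [ι2, ι2] at hxy
          rw [Fin.natAdd_injective _ _ hxy]
    · intro v u huv
      induction u using Fin.addCases with
      | left b =>
        rw [ι1] at huv
        exact ⟨b, Fin.castAdd_injective _ _ huv, rfl⟩
      | right b => rw [ι2] at huv; exact absurd huv (ne _ _)
    · intro w
      induction w using Fin.addCases with
      | left v => exact Or.inl ⟨v, rfl⟩
      | right x => exact Or.inr ⟨Fin.natAdd 4 x, (ι2 x).symm⟩
  obtain ⟨K', hF, hanti'⟩ := surgery hG.piece G K hanti hD
  have cnt := fun (p : Fin (n + k) × Fin (n + k) × Fin (n + k) → Prop) (_ : DecidablePred p) =>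
    card_filter_newF hG.piece G K.dart_unique hD p
  refine ⟨K', hanti', ?_, φ', ?_, ?_, ?_⟩
  · have := cnt (fun _ => True) inferInstance
    simp only [Finset.filter_true, hG.card] at this
    rw [hF]
    have hD6 : D4.card = 6 := by decide
    push_cast
    omega
  · intro x hx
    rw [hF] at hx
    rcases mem_newF.1 hx with ⟨y, hy, _, rfl⟩ | ⟨y, hy, rfl⟩
    · simpa only [mp, φj] using hsim y hy
    · obtain ⟨t, ht, hs⟩ := hG.smp y hy
      refine ⟨sp t, Finset.mem_image.2 ⟨t, by rw [hT]; exact ht, rfl⟩, ?_⟩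
      simpa only [mp, φι] using hs
  · intro p q r hpqr
    have h0 := hdeg p q r hpqr
    have h1 := hG.deg (p, q, r) (hT ▸ hpqr)
    have c1 := cnt (fun x => (φ' x.1, φ' x.2.1, φ' x.2.2) = (p, q, r)) inferInstance
    have c2 := cnt (fun x => (φ' x.1, φ' x.2.1, φ' x.2.2) = (p, r, q)) inferInstance
    simp only [mp, φj, φι, hlab] at c1 c2 h1
    rw [hF]
    push_cast
    have i1 : (P.filter fun x => (ps x.1, ps x.2.1, ps x.2.2) = (p, q, r)).card +
        (D4.filter fun x => (lab4 x.1, lab4 x.2.1, lab4 x.2.2) = (p, r, q)).card =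
        e + (P.filter fun x => (ps x.1, ps x.2.1, ps x.2.2) = (p, r, q)).card +
        (D4.filter fun x => (lab4 x.1, lab4 x.2.1, lab4 x.2.2) = (p, q, r)).card := by
      convert h1 <;> exact Finset.filter_congr fun _ _ => Iff.rfl
    have i2 : ((newF j ι κ K.F D4 P).filter
          fun x => (φ' x.1, φ' x.2.1, φ' x.2.2) = (p, q, r)).card +
        (D4.filter fun x => (lab4 x.1, lab4 x.2.1, lab4 x.2.2) = (p, q, r)).card =
        (K.F.filter fun x => (φ x.1, φ x.2.1, φ x.2.2) = (p, q, r)).card +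
        (P.filter fun x => (ps x.1, ps x.2.1, ps x.2.2) = (p, q, r)).card := by
      convert c1 <;> exact Finset.filter_congr fun _ _ => Iff.rfl
    have i3 : ((newF j ι κ K.F D4 P).filter
          fun x => (φ' x.1, φ' x.2.1, φ' x.2.2) = (p, r, q)).card +
        (D4.filter fun x => (lab4 x.1, lab4 x.2.1, lab4 x.2.2) = (p, r, q)).card =
        (K.F.filter fun x => (φ x.1, φ x.2.1, φ x.2.2) = (p, r, q)).card +
        (P.filter fun x => (ps x.1, ps x.2.1, ps x.2.2) = (p, r, q)).card := by
      convert c2 <;> exact Finset.filter_congr fun _ _ => Iff.rfl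
    omega
  · obtain ⟨κ', hκ', hP, hl⟩ := hG.nxt
    refine ⟨ι ∘ κ', G.hι.comp hκ', ?_, fun b => by simp [φι, hl]⟩
    intro x hx
    rw [hF]
    exact mem_newF.2 (Or.inr ⟨_, hP x hx, rfl⟩)

lemma inv_double (T : OSurf (Fin 7)) (hT : T.F = torusF) (i : ℕ) :
    Inv T (12 * i + 7) (i + 1) (2 * i + 1) := by
  induction i with
  | zero => exact inv_base T hT
  | succ i ih => 
    have := inv_step T hT good2 ih
    convert this using 1 <;> omega

lemma inv_all (T : OSurf (Fin 7)) (hT : T.F = torusF) (i s : ℕ) :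
    Inv T (12 * i + 7 + 6 * s) (i + 1 + s) (2 * i + 1 + s) := by
  induction s with
  | zero => exact inv_double T hT i
  | succ s ih => 
    have := inv_step T hT good1 ih
    convert this using 1 <;> omega

end Surg

/-- For `g ≥ 2` and `0 ≤ i ≤ g - 2` there is a triangulation of
the closed orientable genus `g` surface with `6(g+i) + 1` vertices admitting a
simplicial map of degree `g + i` onto the `7`-vertex torus. -/
theorem stmt13 (g i : ℕ) (hg : 2 ≤ g) (hi : i ≤ g - 2)
    (T : OSurf (Fin 7)) (hT : T.F = torusF) :
    ∃ K : OSurf (Fin (6 * (g + i) + 1)), K.genusIs g ∧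
      ∃ φ : Fin (6 * (g + i) + 1) → Fin 7,
        IsSimplicialMap K T φ ∧ HasDegree K T φ ((g : ℤ) + i) := by
  have h := Surg.inv_all T hT i (g - 1 - i)
  have e1 : 12 * i + 7 + 6 * (g - 1 - i) = 6 * (g + i) + 1 := by omega
  have e2 : i + 1 + (g - 1 - i) = g := by omega
  have e3 : 2 * i + 1 + (g - 1 - i) = g + i := by omega
  rw [e1, e2, e3] at h
  obtain ⟨K, hanti, hcard, φ, hsim, hdeg, _⟩ := h
  refine ⟨K, Surg.genus_of_card K hanti g (by simpa using hcard), φ, hsim, ?_⟩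
  simpa using hdeg
end

section
/- For g ≥ 2 and any integer i with 1 ≤ i ≤ g - 1, there exists a triangulation of the closed orientable genus g surface with 6g - 2i + 1 vertices admitting a simplicial map of degree g - i onto the 7-vertex triangulation of the torus. -/
variable {V W : Type} [DecidableEq V] [Fintype V] [DecidableEq W] [Fintype W]

namespace Glue
set_option linter.unusedSectionVars false
open Relation

/-- The combinatorial invariants of a coherently oriented surface, on the vertices that occur. -/
structure Good {U : Type} (F : Finset (U × U × U)) : Prop where
  rot : ∀ a b c, (a, b, c) ∈ F → (b, c, a) ∈ F
  nd : ∀ a b c, (a, b, c) ∈ F → a ≠ b ∧ b ≠ c ∧ a ≠ c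
  uniq : ∀ a b c c', (a, b, c) ∈ F → (a, b, c') ∈ F → c = c'
  rev : ∀ a b c, (a, b, c) ∈ F → ∃ c', (b, a, c') ∈ F
  noopp : ∀ a b c, (a, b, c) ∈ F → (a, c, b) ∉ F
  vc : ∀ u p q v r s, (u, p, q) ∈ F → (v, r, s) ∈ F →
    ReflTransGen (fun x y => ∃ z, (x, y, z) ∈ F) u v
  cyc : ∀ v p q p' q', (v, p, q) ∈ F → (v, p', q') ∈ F →
    ReflTransGen (fun x y => (v, x, y) ∈ F) p p'

lemma rmono {U : Type} {r p : U → U → Prop} {x y : U} (h : ReflTransGen r x y)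
    (k : ∀ s t, r s t → p s t) : ReflTransGen p x y := h.lift id k

section
variable {U : Type} [DecidableEq U]

/-- The three rotations of an oriented triangle. -/
def R (a b c : U) : Finset (U × U × U) := {(a, b, c), (b, c, a), (c, a, b)}

lemma R_rot (a b c : U) : R b c a = R a b c := by
  ext x; simp only [R, Finset.mem_insert, Finset.mem_singleton]; tauto

lemma mem_R {a b c x y z : U} : (x, y, z) ∈ R a b c ↔
    (x = a ∧ y = b ∧ z = c) ∨ (x = b ∧ y = c ∧ z = a) ∨ (x = c ∧ y = a ∧ z = b) := by
  simp [R]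

/-- Connected sum along an oriented triangle. -/
def glue (F G : Finset (U × U × U)) (a b c : U) : Finset (U × U × U) :=
  (F \ R a b c) ∪ (G \ R a c b)

lemma mem_glue {F G : Finset (U × U × U)} {a b c : U} {x : U × U × U} :
    x ∈ glue F G a b c ↔ (x ∈ F ∧ x ∉ R a b c) ∨ (x ∈ G ∧ x ∉ R a c b) := by
  simp [glue]

lemma glue_rot (F G : Finset (U × U × U)) (a b c : U) : glue F G b c a = glue F G a b c := by
  rw [glue, glue, R_rot, show R b a c = R a c b from (R_rot b a c).symm]

lemma Good.rot2 {F : Finset (U × U × U)} (h : Good F) {a b c : U} (m : (a, b, c) ∈ F) :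
    (c, a, b) ∈ F := h.rot _ _ _ (h.rot _ _ _ m)

lemma Good.inR {F : Finset (U × U × U)} (h : Good F) {a b c p q r : U} (m : (a, b, c) ∈ F)
    (k : (p, q, r) ∈ R a b c) : (p, q, r) ∈ F := by
  rw [mem_R] at k
  rcases k with ⟨rfl, rfl, rfl⟩ | ⟨rfl, rfl, rfl⟩ | ⟨rfl, rfl, rfl⟩
  exacts [m, h.rot _ _ _ m, h.rot2 m]

lemma Good.to_b {F : Finset (U × U × U)} (h : Good F) {a b c p : U} (m : (a, b, c) ∈ F)
    (hp : ReflTransGen (fun x y => (a, x, y) ∈ F) p b) :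
    ReflTransGen (fun x y => (a, x, y) ∈ F ∧ (a, x, y) ∉ R a b c) p b := by
  have := h.nd _ _ _ m
  induction hp using ReflTransGen.head_induction_on with
  | refl => exact .refl
  | @head x y h1 _ ih =>
    by_cases e : x = b
    · subst e; exact .refl
    · exact .head ⟨h1, by rw [mem_R]; tauto⟩ ih

lemma Good.from_c {F : Finset (U × U × U)} (h : Good F) {a b c p : U} (m : (a, b, c) ∈ F)
    (hp : ReflTransGen (fun x y => (a, x, y) ∈ F) c p) :
    ReflTransGen (fun x y => (a, x, y) ∈ F ∧ (a, x, y) ∉ R a b c) c p := by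
  have := h.nd _ _ _ m
  induction hp with
  | refl => exact .refl
  | @tail x y _ h1 ih =>
    by_cases e : x = b
    · subst e
      have := h.uniq _ _ _ _ h1 m
      subst this; exact .refl
    · exact .tail ih ⟨h1, by rw [mem_R]; tauto⟩

variable {F G : Finset (U × U × U)} {a b c : U}

lemma cyc_a (hF : Good F) (hG : Good G) (mF : (a, b, c) ∈ F) (mG : (a, c, b) ∈ G)
    (p q p' q' : U) (h1 : (a, p, q) ∈ glue F G a b c) (h2 : (a, p', q') ∈ glue F G a b c) :
    ReflTransGen (fun x y => (a, x, y) ∈ glue F G a b c) p p' := by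
  have mF' : (a, c, _) ∈ F := (hF.rev _ _ _ (hF.rot2 mF)).choose_spec
  have mG' : (a, b, _) ∈ G := (hG.rev _ _ _ (hG.rot2 mG)).choose_spec
  have iF : ∀ x y, ReflTransGen (fun x y => (a, x, y) ∈ F ∧ (a, x, y) ∉ R a b c) x y →
      ReflTransGen (fun x y => (a, x, y) ∈ glue F G a b c) x y := fun x y h =>
    rmono h fun x y h => mem_glue.2 (.inl h)
  have iG : ∀ x y, ReflTransGen (fun x y => (a, x, y) ∈ G ∧ (a, x, y) ∉ R a c b) x y →
      ReflTransGen (fun x y => (a, x, y) ∈ glue F G a b c) x y := fun x y h =>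
    rmono h fun x y h => mem_glue.2 (.inr h)
  have cb := iF _ _ (hF.to_b mF (hF.cyc _ _ _ _ _ mF' mF))
  have bc := iG _ _ (hG.to_b mG (hG.cyc _ _ _ _ _ mG' mG))
  have pb : ReflTransGen (fun x y => (a, x, y) ∈ glue F G a b c) p b := by
    rcases mem_glue.1 h1 with h | h
    · exact iF _ _ (hF.to_b mF (hF.cyc _ _ _ _ _ h.1 mF))
    · exact (iG _ _ (hG.to_b mG (hG.cyc _ _ _ _ _ h.1 mG))).trans cb
  have bp : ReflTransGen (fun x y => (a, x, y) ∈ glue F G a b c) b p' := by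
    rcases mem_glue.1 h2 with h | h
    · exact bc.trans (iF _ _ (hF.from_c mF (hF.cyc _ _ _ _ _ mF' h.1)))
    · exact iG _ _ (hG.from_c mG (hG.cyc _ _ _ _ _ mG' h.1))
  exact pb.trans bp

lemma not_R_of_ne {v x y : U} (ha : v ≠ a) (hb : v ≠ b) (hc : v ≠ c) :
    (v, x, y) ∉ R a b c := by
  rw [mem_R]; tauto

lemma dart_glue (hF : Good F) (hG : Good G) (mF : (a, b, c) ∈ F) (mG : (a, c, b) ∈ G)
    {x y z : U} (h : (x, y, z) ∈ F ∨ (x, y, z) ∈ G) : ∃ z', (x, y, z') ∈ glue F G a b c := by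
  have key : ∀ {F G : Finset (U × U × U)} {b c : U}, Good F → Good G → (a, b, c) ∈ F →
      (a, c, b) ∈ G → (x, y, z) ∈ F →
      ∃ z', ((x, y, z') ∈ F ∧ (x, y, z') ∉ R a b c) ∨ ((x, y, z') ∈ G ∧ (x, y, z') ∉ R a c b) := by
    intro F G b c hF hG mF mG h
    by_cases k : (x, y, z) ∈ R a b c
    · have n := hF.nd _ _ _ mF
      rw [mem_R] at k
      rcases k with ⟨rfl, rfl, rfl⟩ | ⟨rfl, rfl, rfl⟩ | ⟨rfl, rfl, rfl⟩
      · obtain ⟨w, hw⟩ := hG.rev _ _ _ (hG.rot2 mG)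
        exact ⟨w, .inr ⟨hw, by rw [mem_R]; tauto⟩⟩
      · obtain ⟨w, hw⟩ := hG.rev _ _ _ (hG.rot _ _ _ mG)
        exact ⟨w, .inr ⟨hw, by rw [mem_R]; grind⟩⟩
      · obtain ⟨w, hw⟩ := hG.rev _ _ _ mG
        exact ⟨w, .inr ⟨hw, by rw [mem_R]; grind⟩⟩
    · exact ⟨z, .inl ⟨h, k⟩⟩
  rcases h with h | h
  · obtain ⟨w, hw⟩ := key hF hG mF mG h
    exact ⟨w, mem_glue.2 hw⟩
  · obtain ⟨w, hw⟩ := key hG hF mG mF h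
    exact ⟨w, mem_glue.2 hw.symm⟩

/-- A dart common to both sides cannot survive on both sides. -/
lemma cross (hF : Good F) (hG : Good G) (mF : (a, b, c) ∈ F) (mG : (a, c, b) ∈ G)
    (hI : ∀ v p q r s, (v, p, q) ∈ F → (v, r, s) ∈ G → v = a ∨ v = b ∨ v = c)
    (p q r s : U) (h1 : (p, q, r) ∈ F) (h1' : (p, q, r) ∉ R a b c) (h2 : (p, q, s) ∈ G)
    (h2' : (p, q, s) ∉ R a c b) : False := by
  have hp := hI _ _ _ _ _ h1 h2
  have hq := hI _ _ _ _ _ (hF.rot _ _ _ h1) (hG.rot _ _ _ h2)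
  have npq := (hF.nd _ _ _ h1).1
  have u1 := fun w => hF.uniq p q r w h1
  have u2 := fun w => hG.uniq p q s w h2
  have mF1 := hF.rot _ _ _ mF
  have mF2 := hF.rot2 mF
  have mG1 := hG.rot _ _ _ mG
  have mG2 := hG.rot2 mG
  rw [mem_R] at h1' h2'
  rcases hp with rfl | rfl | rfl <;> rcases hq with rfl | rfl | rfl
  · exact npq rfl
  · exact h1' (.inl ⟨rfl, rfl, u1 _ mF⟩)
  · exact h2' (.inl ⟨rfl, rfl, u2 _ mG⟩)
  · exact h2' (.inr (.inr ⟨rfl, rfl, u2 _ mG2⟩))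
  · exact npq rfl
  · exact h1' (.inr (.inl ⟨rfl, rfl, u1 _ mF1⟩))
  · exact h1' (.inr (.inr ⟨rfl, rfl, u1 _ mF2⟩))
  · exact h2' (.inr (.inl ⟨rfl, rfl, u2 _ mG1⟩))
  · exact npq rfl

theorem Good.glue (hF : Good F) (hG : Good G) (mF : (a, b, c) ∈ F) (mG : (a, c, b) ∈ G)
    (hI : ∀ v p q r s, (v, p, q) ∈ F → (v, r, s) ∈ G → v = a ∨ v = b ∨ v = c) :
    Good (glue F G a b c) := by
  have n := hF.nd _ _ _ mF
  refine ⟨?_, ?_, ?_, ?_, ?_, ?_, ?_⟩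
  · intro x y z h
    rw [mem_glue] at h ⊢
    rw [mem_R, mem_R] at h ⊢
    rcases h with h | h
    · exact .inl ⟨hF.rot _ _ _ h.1, by tauto⟩
    · exact .inr ⟨hG.rot _ _ _ h.1, by tauto⟩
  · intro x y z h
    rcases mem_glue.1 h with h | h
    exacts [hF.nd _ _ _ h.1, hG.nd _ _ _ h.1]
  · intro x y z z' h h'
    rcases mem_glue.1 h with h | h <;> rcases mem_glue.1 h' with h' | h'
    · exact hF.uniq _ _ _ _ h.1 h'.1
    · exact (cross hF hG mF mG hI _ _ _ _ h.1 h.2 h'.1 h'.2).elim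
    · exact (cross hF hG mF mG hI _ _ _ _ h'.1 h'.2 h.1 h.2).elim
    · exact hG.uniq _ _ _ _ h.1 h'.1
  · intro x y z h
    rcases mem_glue.1 h with h | h
    · obtain ⟨w, hw⟩ := hF.rev _ _ _ h.1
      exact dart_glue hF hG mF mG (.inl hw)
    · obtain ⟨w, hw⟩ := hG.rev _ _ _ h.1
      exact dart_glue hF hG mF mG (.inr hw)
  · have mix : ∀ x y z, (x, y, z) ∈ F → (x, y, z) ∉ R a b c → (x, z, y) ∈ G → False := by
      intro x y z h h1 h'
      have hx := hI _ _ _ _ _ h h'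
      have hy := hI _ _ _ _ _ (hF.rot _ _ _ h) (hG.rot2 h')
      have hz := hI _ _ _ _ _ (hF.rot2 h) (hG.rot _ _ _ h')
      have nn := hF.nd _ _ _ h
      have o1 := hF.noopp _ _ _ mF
      have o2 := hF.noopp _ _ _ (hF.rot _ _ _ mF)
      have o3 := hF.noopp _ _ _ (hF.rot2 mF)
      rw [mem_R] at h1
      rcases hx with rfl | rfl | rfl <;> rcases hy with rfl | rfl | rfl <;>
        rcases hz with rfl | rfl | rfl <;> first
        | exact nn.1 rfl
        | exact nn.2.1 rfl
        | exact nn.2.2 rfl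
        | exact o1 h
        | exact o2 h
        | exact o3 h
        | exact h1 (.inl ⟨rfl, rfl, rfl⟩)
        | exact h1 (.inr (.inl ⟨rfl, rfl, rfl⟩))
        | exact h1 (.inr (.inr ⟨rfl, rfl, rfl⟩))
    intro x y z h h'
    rcases mem_glue.1 h with h | h <;> rcases mem_glue.1 h' with h' | h'
    · exact hF.noopp _ _ _ h.1 h'.1
    · exact mix _ _ _ h.1 h.2 h'.1
    · exact mix _ _ _ h'.1 h'.2 h.1
    · exact hG.noopp _ _ _ h.1 h'.1
  · intro u p q v r s h h'
    have iF : ∀ x y, ReflTransGen (fun x y => ∃ z, (x, y, z) ∈ F) x y →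
        ReflTransGen (fun x y => ∃ z, (x, y, z) ∈ Glue.glue F G a b c) x y := fun x y h =>
      rmono h fun x y ⟨z, h⟩ => dart_glue hF hG mF mG (.inl h)
    have iG : ∀ x y, ReflTransGen (fun x y => ∃ z, (x, y, z) ∈ G) x y →
        ReflTransGen (fun x y => ∃ z, (x, y, z) ∈ Glue.glue F G a b c) x y := fun x y h =>
      rmono h fun x y ⟨z, h⟩ => dart_glue hF hG mF mG (.inr h)
    refine ReflTransGen.trans (b := a) ?_ ?_
    · rcases mem_glue.1 h with h | h
      · exact iF _ _ (hF.vc _ _ _ _ _ _ h.1 mF)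
      · exact iG _ _ (hG.vc _ _ _ _ _ _ h.1 mG)
    · rcases mem_glue.1 h' with h | h
      · exact iF _ _ (hF.vc _ _ _ _ _ _ mF h.1)
      · exact iG _ _ (hG.vc _ _ _ _ _ _ mG h.1)
  · intro v p q p' q' h h'
    by_cases ha : v = a
    · subst ha; exact cyc_a hF hG mF mG _ _ _ _ h h'
    by_cases hb : v = b
    · subst hb
      rw [← glue_rot] at h h' ⊢
      exact cyc_a hF hG (hF.rot _ _ _ mF) (hG.rot2 mG) _ _ _ _ h h'
    by_cases hc : v = c
    · subst hc
      rw [← glue_rot, ← glue_rot] at h h' ⊢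
      exact cyc_a hF hG (hF.rot2 mF) (hG.rot _ _ _ mG) _ _ _ _ h h'
    rcases mem_glue.1 h with h | h <;> rcases mem_glue.1 h' with h' | h'
    · exact rmono (hF.cyc _ _ _ _ _ h.1 h'.1) fun x y k =>
        mem_glue.2 (.inl ⟨k, not_R_of_ne ha hb hc⟩)
    · exact absurd (hI _ _ _ _ _ h.1 h'.1) (by tauto)
    · exact absurd (hI _ _ _ _ _ h'.1 h.1) (by tauto)
    · exact rmono (hG.cyc _ _ _ _ _ h.1 h'.1) fun x y k =>
        mem_glue.2 (.inr ⟨k, not_R_of_ne ha hc hb⟩)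

lemma Good.R_subset (hF : Good F) (mF : (a, b, c) ∈ F) : R a b c ⊆ F := by
  rintro ⟨x, y, z⟩ h; exact hF.inR mF h

lemma Good.sum_R (hF : Good F) (mF : (a, b, c) ∈ F) (w : U × U × U → ℤ) :
    ∑ x ∈ R a b c, w x = w (a, b, c) + w (b, c, a) + w (c, a, b) := by
  have n := hF.nd _ _ _ mF
  rw [R, Finset.sum_insert, Finset.sum_insert, Finset.sum_singleton]
  · ring
  · simp; tauto
  · simp; tauto

theorem sum_glue (hF : Good F) (hG : Good G) (mF : (a, b, c) ∈ F) (mG : (a, c, b) ∈ G)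
    (hI : ∀ v p q r s, (v, p, q) ∈ F → (v, r, s) ∈ G → v = a ∨ v = b ∨ v = c)
    (w : U × U × U → ℤ) :
    ∑ x ∈ glue F G a b c, w x = ∑ x ∈ F, w x + ∑ x ∈ G, w x
      - (w (a, b, c) + w (b, c, a) + w (c, a, b)) - (w (a, c, b) + w (c, b, a) + w (b, a, c)) := by
  have n := hF.nd _ _ _ mF
  rw [glue, Finset.sum_union, ← Finset.sum_sdiff (hF.R_subset mF),
    ← Finset.sum_sdiff (hG.R_subset mG), hF.sum_R mF, hG.sum_R mG]
  · ring
  · rw [Finset.disjoint_left]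
    rintro ⟨x, y, z⟩ h h'
    rw [Finset.mem_sdiff] at h h'
    exact cross hF hG mF mG hI _ _ _ _ h.1 h.2 h'.1 h'.2

end

/-- Relabel a triple. -/
def tm {U V : Type} (i : U → V) (x : U × U × U) : V × V × V := (i x.1, i x.2.1, i x.2.2)

lemma tm_inj {U V : Type} {i : U → V} (hi : Function.Injective i) :
    Function.Injective (tm i) := by
  rintro ⟨a, b, c⟩ ⟨a', b', c'⟩ h
  simp only [tm, Prod.mk.injEq] at h
  rw [hi h.1, hi h.2.1, hi h.2.2]

section
variable {U V : Type} [DecidableEq U] [DecidableEq V]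

lemma mem_tm {i : U → V} {F : Finset (U × U × U)} {a b c : V} :
    (a, b, c) ∈ F.image (tm i) ↔ ∃ x y z, (x, y, z) ∈ F ∧ i x = a ∧ i y = b ∧ i z = c := by
  simp [tm]

lemma mem_tm' {i : U → V} (hi : Function.Injective i) {F : Finset (U × U × U)} {a b c : U} :
    (i a, i b, i c) ∈ F.image (tm i) ↔ (a, b, c) ∈ F := by
  rw [mem_tm]
  constructor
  · rintro ⟨x, y, z, h, h1, h2, h3⟩
    rwa [← hi h1, ← hi h2, ← hi h3]
  · intro h; exact ⟨_, _, _, h, rfl, rfl, rfl⟩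

theorem Good.map {i : U → V} (hi : Function.Injective i) {F : Finset (U × U × U)} (h : Good F) :
    Good (F.image (tm i)) := by
  refine ⟨?_, ?_, ?_, ?_, ?_, ?_, ?_⟩
  · intro a b c k0
    obtain ⟨x, y, z, k, rfl, rfl, rfl⟩ := mem_tm.1 k0
    exact (mem_tm' hi).2 (h.rot _ _ _ k)
  · intro a b c k0
    obtain ⟨x, y, z, k, rfl, rfl, rfl⟩ := mem_tm.1 k0
    simpa [hi.eq_iff] using h.nd _ _ _ k
  · intro a b c c' k0 k1
    obtain ⟨x, y, z, k, rfl, rfl, rfl⟩ := mem_tm.1 k0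
    obtain ⟨x', y', z', k', h1, h2, rfl⟩ := mem_tm.1 k1
    rw [hi h1, hi h2] at k'
    rw [h.uniq _ _ _ _ k k']
  · intro a b c k0
    obtain ⟨x, y, z, k, rfl, rfl, rfl⟩ := mem_tm.1 k0
    obtain ⟨w, hw⟩ := h.rev _ _ _ k
    exact ⟨i w, (mem_tm' hi).2 hw⟩
  · intro a b c k0 k1
    obtain ⟨x, y, z, k, rfl, rfl, rfl⟩ := mem_tm.1 k0
    exact h.noopp _ _ _ k ((mem_tm' hi).1 k1)
  · intro u p q v r s k0 k1
    obtain ⟨x, y, z, k, rfl, rfl, rfl⟩ := mem_tm.1 k0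
    obtain ⟨x', y', z', k', rfl, rfl, rfl⟩ := mem_tm.1 k1
    exact (h.vc _ _ _ _ _ _ k k').lift i fun s t ⟨z, hz⟩ => ⟨i z, (mem_tm' hi).2 hz⟩
  · intro u p q r s k0 k1
    obtain ⟨x, y, z, k, rfl, rfl, rfl⟩ := mem_tm.1 k0
    obtain ⟨x', y', z', k', h1, rfl, rfl⟩ := mem_tm.1 k1
    rw [hi h1] at k'
    exact (h.cyc _ _ _ _ _ k k').lift i fun s t hz => (mem_tm' hi).2 hz

end

/-- From invariants to a surface. -/
def Good.toSurf {V : Type} [DecidableEq V] [Fintype V] {F : Finset (V × V × V)} (h : Good F)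
    (hc : ∀ v : V, ∃ b c, (v, b, c) ∈ F) : OSurf V :=
  have two : ∀ {a b : V} {s t : Finset V}, a ≠ b → a ∈ s → b ∈ s → a ∈ t → b ∈ t →
      2 ≤ (s ∩ t).card := by
    intro a b s t hab h1 h2 h3 h4
    have : ({a, b} : Finset V) ⊆ s ∩ t := by
      intro x; simp only [Finset.mem_insert, Finset.mem_singleton, Finset.mem_inter]
      rintro (rfl | rfl) <;> tauto
    simpa [Finset.card_pair hab] using Finset.card_le_card this
  have link : ∀ v : V, ∀ x ∈ F, ∀ y ∈ F,
    v ∈ ({x.1, x.2.1, x.2.2} : Finset V) → v ∈ ({y.1, y.2.1, y.2.2} : Finset V) →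
    ReflTransGen (fun s t : V × V × V => s ∈ F ∧ t ∈ F ∧
      v ∈ ({s.1, s.2.1, s.2.2} : Finset V) ∧ v ∈ ({t.1, t.2.1, t.2.2} : Finset V) ∧
      2 ≤ (({s.1, s.2.1, s.2.2} : Finset V) ∩ {t.1, t.2.1, t.2.2}).card) x y := by
    have norm : ∀ v : V, ∀ x ∈ F, v ∈ ({x.1, x.2.1, x.2.2} : Finset V) →
        ∃ p q, (v, p, q) ∈ F ∧ ({v, p, q} : Finset V) = {x.1, x.2.1, x.2.2} := by
      rintro v ⟨a, b, c⟩ hx hv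
      simp only [Finset.mem_insert, Finset.mem_singleton] at hv
      rcases hv with rfl | rfl | rfl
      · exact ⟨_, _, hx, rfl⟩
      · exact ⟨_, _, h.rot _ _ _ hx, by ext; simp; tauto⟩
      · exact ⟨_, _, h.rot _ _ _ (h.rot _ _ _ hx), by ext; simp; tauto⟩
    intro v x hx y hy vx vy
    obtain ⟨p, q, h1, e1⟩ := norm v x hx vx
    obtain ⟨r, s, h2, e2⟩ := norm v y hy vy
    have main : ∀ r, ReflTransGen (fun x y => (v, x, y) ∈ F) p r → ∀ s, (v, r, s) ∈ F →
        ReflTransGen (fun s t : V × V × V => s ∈ F ∧ t ∈ F ∧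
        v ∈ ({s.1, s.2.1, s.2.2} : Finset V) ∧ v ∈ ({t.1, t.2.1, t.2.2} : Finset V) ∧
        2 ≤ (({s.1, s.2.1, s.2.2} : Finset V) ∩ {t.1, t.2.1, t.2.2}).card) (v, p, q) (v, r, s) := by
      intro r hr
      induction hr with
      | refl => intro s hs; rw [h.uniq _ _ _ _ h1 hs]
      | tail _ k ih =>
        intro s hs
        refine (ih _ k).tail ⟨k, hs, by simp, by simp, ?_⟩
        exact two (h.nd _ _ _ hs).1 (by simp) (by simp) (by simp) (by simp)
    refine ReflTransGen.head (b := (v, p, q)) ⟨hx, h1, vx, by simp, ?_⟩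
      ((main r (h.cyc _ _ _ _ _ h1 h2) s h2).tail ⟨h2, hy, by simp, vy, ?_⟩)
    · rw [← e1]
      exact two (h.nd _ _ _ h1).1 (by simp) (by simp) (by simp) (by simp)
    · rw [← e2]
      exact two (h.nd _ _ _ h2).1 (by simp) (by simp) (by simp) (by simp)
  { F := F
    rot_mem := h.rot
    nondegen := h.nd
    dart_unique := h.uniq
    dart_rev := h.rev
    vertex_cover := hc
    connected := by
      have wk : ∀ v : V, ∀ x ∈ F, ∀ y ∈ F, x.1 = v → y.1 = v → 
          ReflTransGen (fun s t : V × V × V => s ∈ F ∧ t ∈ F ∧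
          2 ≤ (({s.1, s.2.1, s.2.2} : Finset V) ∩ {t.1, t.2.1, t.2.2}).card) x y := by
        intro v x hx y hy e1 e2
        exact rmono (link v x hx y hy (by simp [e1]) (by simp [e2])) fun s t k =>
          ⟨k.1, k.2.1, k.2.2.2.2⟩
      rintro ⟨u, p, q⟩ hx ⟨v, r, s⟩ hy
      have := h.vc _ _ _ _ _ _ hx hy
      clear hc link
      induction this generalizing r s with
      | refl => exact wk u _ hx _ hy rfl rfl
      | tail _ k ih =>
        obtain ⟨z, hz⟩ := k
        have hz' := h.rot _ _ _ hz
        refine ((ih _ _ hz).tail ⟨hz, hz', ?_⟩).trans (wk _ _ hz' _ hy rfl rfl)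
        exact two (h.nd _ _ _ hz).1 (by simp) (by simp) (by simp) (by simp)
    link_connected := link }

lemma set_eq {V : Type} [DecidableEq V] {a b c x y z : V} (h1 : x ≠ y) (h2 : y ≠ z) (h3 : x ≠ z)
    (h : ({x, y, z} : Finset V) = {a, b, c}) :
    (x, y, z) ∈ R a b c ∨ (x, y, z) ∈ R a c b := by
  have hx : x ∈ ({a, b, c} : Finset V) := by rw [← h]; simp
  have hy : y ∈ ({a, b, c} : Finset V) := by rw [← h]; simp
  have hz : z ∈ ({a, b, c} : Finset V) := by rw [← h]; simp
  simp only [Finset.mem_insert, Finset.mem_singleton] at hx hy hz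
  rw [mem_R, mem_R]
  rcases hx with rfl | rfl | rfl <;> rcases hy with rfl | rfl | rfl <;>
    rcases hz with rfl | rfl | rfl <;> simp_all

lemma Good.faces_card {V : Type} [DecidableEq V] [Fintype V] (K : OSurf V) (h : Good K.F) :
    K.F.card = 3 * K.faces.card := by
  rw [OSurf.faces, mul_comm, Finset.card_eq_sum_card_image
    (fun x : V × V × V => ({x.1, x.2.1, x.2.2} : Finset V)) K.F]
  refine Finset.sum_const_nat ?_
  intro t ht
  obtain ⟨⟨a, b, c⟩, hm, rfl⟩ := Finset.mem_image.1 ht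
  have n := h.nd _ _ _ hm
  have : {x ∈ K.F | ({x.1, x.2.1, x.2.2} : Finset V) = {a, b, c}} = R a b c := by
    ext ⟨x, y, z⟩
    rw [Finset.mem_filter]
    constructor
    · rintro ⟨h1, h2⟩
      have n := h.nd _ _ _ h1
      rcases set_eq n.1 n.2.1 n.2.2 h2 with h3 | h3
      · exact h3
      · exfalso
        rw [mem_R] at h3
        rcases h3 with ⟨rfl, rfl, rfl⟩ | ⟨rfl, rfl, rfl⟩ | ⟨rfl, rfl, rfl⟩
        · exact h.noopp _ _ _ hm h1
        · exact h.noopp _ _ _ hm (h.rot2 h1)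
        · exact h.noopp _ _ _ hm (h.rot _ _ _ h1)
    · intro h1
      refine ⟨h.inR hm h1, ?_⟩
      rw [mem_R] at h1
      rcases h1 with ⟨rfl, rfl, rfl⟩ | ⟨rfl, rfl, rfl⟩ | ⟨rfl, rfl, rfl⟩ <;>
        (ext; simp; try tauto)
  rw [this, R, Finset.card_insert_of_notMem, Finset.card_pair]
  · simp; tauto
  · simp; tauto

lemma Good.edges_card {V : Type} [DecidableEq V] [Fintype V] (K : OSurf V) (h : Good K.F) :
    K.F.card = 2 * K.edges.card := by
  have e1 : (K.F.image fun x => (x.1, x.2.1)).card = K.F.card := by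
    apply Finset.card_image_of_injOn
    rintro ⟨a, b, c⟩ h1 ⟨a', b', c'⟩ h2 e
    simp only [Prod.mk.injEq] at e
    obtain ⟨rfl, rfl⟩ := e
    rw [h.uniq _ _ _ _ h1 h2]
  have e2 : K.edges = (K.F.image fun x => (x.1, x.2.1)).image
      fun x => ({x.1, x.2} : Finset V) := by
    ext t
    simp only [OSurf.edges, OSurf.faces, Finset.mem_biUnion, Finset.mem_image,
      Finset.mem_powersetCard]
    constructor
    · rintro ⟨_, ⟨⟨a, b, c⟩, hm, rfl⟩, h1, h2⟩
      obtain ⟨x, y, hxy, rfl⟩ := Finset.card_eq_two.1 h2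
      have hx : x ∈ ({a, b, c} : Finset V) := h1 (by simp)
      have hy : y ∈ ({a, b, c} : Finset V) := h1 (by simp)
      simp only [Finset.mem_insert, Finset.mem_singleton] at hx hy
      have m1 := h.rot _ _ _ hm
      have m2 := h.rot2 hm
      rcases hx with rfl | rfl | rfl <;> rcases hy with rfl | rfl | rfl <;> first
        | exact absurd rfl hxy
        | exact ⟨_, ⟨_, hm, rfl⟩, rfl⟩
        | exact ⟨_, ⟨_, m1, rfl⟩, rfl⟩
        | exact ⟨_, ⟨_, m2, rfl⟩, rfl⟩
        | exact ⟨_, ⟨_, hm, rfl⟩, Finset.pair_comm _ _⟩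
        | exact ⟨_, ⟨_, m1, rfl⟩, Finset.pair_comm _ _⟩
        | exact ⟨_, ⟨_, m2, rfl⟩, Finset.pair_comm _ _⟩
    · rintro ⟨_, ⟨⟨a, b, c⟩, hm, rfl⟩, rfl⟩
      refine ⟨_, ⟨_, hm, rfl⟩, ?_, Finset.card_pair (h.nd _ _ _ hm).1⟩
      intro x; simp; tauto
  rw [← e1, e2, mul_comm, Finset.card_eq_sum_card_image
    (fun x : V × V => ({x.1, x.2} : Finset V)) (K.F.image fun x => (x.1, x.2.1))]
  refine Finset.sum_const_nat ?_
  intro t ht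
  obtain ⟨⟨a, b⟩, hm0, rfl⟩ := Finset.mem_image.1 ht
  obtain ⟨⟨a', b', c⟩, hm, e⟩ := Finset.mem_image.1 hm0
  simp only [Prod.mk.injEq] at e
  obtain ⟨rfl, rfl⟩ := e
  have n := h.nd _ _ _ hm
  obtain ⟨c', hr⟩ := h.rev _ _ _ hm
  have : {x ∈ K.F.image fun x => (x.1, x.2.1) | ({x.1, x.2} : Finset V) = {a', b'}}
      = {(a', b'), (b', a')} := by
    ext ⟨x, y⟩
    rw [Finset.mem_filter]
    simp only [Finset.mem_image, Finset.mem_insert, Finset.mem_singleton, Prod.mk.injEq]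
    constructor
    · rintro ⟨⟨⟨p, q, r⟩, h1, rfl, rfl⟩, h2⟩
      have n' := (h.nd _ _ _ h1).1
      have hx : p ∈ ({a', b'} : Finset V) := by rw [← h2]; simp
      have hy : q ∈ ({a', b'} : Finset V) := by rw [← h2]; simp
      simp only [Finset.mem_insert, Finset.mem_singleton] at hx hy
      rcases hx with rfl | rfl <;> rcases hy with rfl | rfl <;> simp_all
    · rintro (⟨rfl, rfl⟩ | ⟨rfl, rfl⟩)
      · exact ⟨⟨_, hm, rfl, rfl⟩, rfl⟩
      · exact ⟨⟨_, hr, rfl, rfl⟩, Finset.pair_comm _ _⟩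
  rw [this, Finset.card_pair]
  simp; tauto

/-- Signed indicator of an oriented facet. -/
def w (t u : Fin 7 × Fin 7 × Fin 7) : ℤ :=
  (if u = (t.1, t.2.1, t.2.2) then 1 else 0) - (if u = (t.1, t.2.2, t.2.1) then 1 else 0)

lemma w_swap (t : Fin 7 × Fin 7 × Fin 7) (x y z : Fin 7) : w t (x, y, z) = - w t (x, z, y) := by
  obtain ⟨p, q, r⟩ := t
  simp only [w, Prod.mk.injEq]
  rw [neg_sub]
  congr 1 <;> (congr 1; simp only [eq_iff_iff]; tauto)

/-- A triple of vertices spanning a simplex of the torus. -/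
def Simp (u : Fin 7 × Fin 7 × Fin 7) : Prop :=
  ∃ t ∈ torusF, ({u.1, u.2.1, u.2.2} : Finset (Fin 7)) ⊆ {t.1, t.2.1, t.2.2}

/-- Everything that is carried along the induction. -/
structure Inv (n : ℕ) (F : Finset (Fin n × Fin n × Fin n)) (φ : Fin n → Fin 7) (g d : ℤ) :
    Prop where
  good : Good F
  cov : ∀ v, ∃ b c, (v, b, c) ∈ F
  card : (F.card : ℤ) = 6 * n + 12 * g - 12
  simpl : ∀ x ∈ F, Simp (tm φ x)
  deg : ∀ t ∈ torusF, ∑ x ∈ F, w t (tm φ x) = d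

lemma Inv.exists_facet {n : ℕ} {F : Finset (Fin n × Fin n × Fin n)} {φ : Fin n → Fin 7} {g d : ℤ}
    (h : Inv n F φ g d) (hd : 0 < d) :
    ∃ a b c, (a, b, c) ∈ F ∧ φ a = 1 ∧ φ b = 2 ∧ φ c = 4 := by
  have h1 := h.deg (1, 2, 4) (by decide)
  rw [← h1] at hd
  obtain ⟨⟨a, b, c⟩, hm, hp⟩ := Finset.exists_lt_of_sum_lt (s := F) (f := fun _ => (0 : ℤ))
    (by simpa using hd)
  refine ⟨a, b, c, hm, ?_⟩
  by_contra hne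
  have : ¬ tm φ (a, b, c) = (1, 2, 4) := by
    simpa [tm] using hne
  simp only [w] at hp
  rw [if_neg this] at hp
  split_ifs at hp <;> omega

theorem step {n m : ℕ} {F : Finset (Fin n × Fin n × Fin n)} {φ : Fin n → Fin 7} {g d e : ℤ}
    {G : Finset (Fin (3 + m) × Fin (3 + m) × Fin (3 + m))} {ψ : Fin (3 + m) → Fin 7}
    (hF : Inv n F φ g d) (hG : Inv (3 + m) G ψ 1 e) (hd : 0 < d)
    (hG1 : (Fin.castAdd m 0, Fin.castAdd m 2, Fin.castAdd m 1) ∈ G)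
    (p0 : ψ (Fin.castAdd m 0) = 1) (p1 : ψ (Fin.castAdd m 1) = 2)
    (p2 : ψ (Fin.castAdd m 2) = 4) :
    ∃ F' φ', Inv (n + m) F' φ' (g + 1) (d + e) := by
  obtain ⟨a, b, c, hm, fa, fb, fc⟩ := hF.exists_facet hd
  have nn := hF.good.nd _ _ _ hm
  set i : Fin n → Fin (n + m) := Fin.castAdd m with hi
  set j : Fin (3 + m) → Fin (n + m) :=
    Fin.append (fun k => Fin.castAdd m (![a, b, c] k)) (Fin.natAdd n) with hj
  set φ' : Fin (n + m) → Fin 7 := Fin.append φ (fun k => ψ (Fin.natAdd 3 k)) with hφ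
  have iI : Function.Injective i := Fin.castAdd_injective n m
  have jl : ∀ k, j (Fin.castAdd m k) = i (![a, b, c] k) := fun k => Fin.append_left _ _ k
  have jr : ∀ k, j (Fin.natAdd 3 k) = Fin.natAdd n k := fun k => Fin.append_right _ _ k
  have ne : ∀ (k : Fin n) (l : Fin m), i k ≠ Fin.natAdd n l := by
    intro k l h
    have := congrArg Fin.val h
    simp only [hi, Fin.val_castAdd, Fin.val_natAdd] at this
    omega
  have vI : Function.Injective ![a, b, c] := by
    intro x y h
    fin_cases x <;> fin_cases y <;> simp at h ⊢ <;> first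
      | exact nn.1 h
      | exact nn.2.1 h
      | exact nn.2.2 h
      | exact nn.1 h.symm
      | exact nn.2.1 h.symm
      | exact nn.2.2 h.symm
  have jI : Function.Injective j := by
    intro x y
    refine Fin.addCases (fun k => ?_) (fun k => ?_) x <;>
      refine Fin.addCases (fun l => ?_) (fun l => ?_) y <;> intro h
    · rw [jl, jl] at h; rw [vI (iI h)]
    · rw [jl, jr] at h; exact absurd h (ne _ _)
    · rw [jl, jr] at h; exact absurd h.symm (ne _ _)
    · rw [jr, jr] at h; rw [Fin.natAdd_injective m n h]
  have φi : ∀ x, φ' (i x) = φ x := fun x => Fin.append_left _ _ x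
  have φj : ∀ x, φ' (j x) = ψ x := by
    intro x
    refine Fin.addCases (fun k => ?_) (fun k => ?_) x
    · rw [jl, φi]
      fin_cases k
      · exact fa.trans p0.symm
      · exact fb.trans p1.symm
      · exact fc.trans p2.symm
    · rw [jr]; exact Fin.append_right _ _ k
  have ti : ∀ x, tm φ' (tm i x) = tm φ x := fun x => by simp [tm, φi]
  have tj : ∀ x, tm φ' (tm j x) = tm ψ x := fun x => by simp [tm, φj]
  have gF := hF.good.map iI
  have gG := hG.good.map jI
  have mF : (i a, i b, i c) ∈ F.image (tm i) := (mem_tm' iI).2 hm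
  have mG : (i a, i c, i b) ∈ G.image (tm j) := by
    have := (mem_tm' jI).2 hG1
    rw [jl, jl, jl] at this
    exact this
  have hI : ∀ v p q r s, (v, p, q) ∈ F.image (tm i) → (v, r, s) ∈ G.image (tm j) →
      v = i a ∨ v = i b ∨ v = i c := by
    intro v p q r s h1 h2
    obtain ⟨x, _, _, _, rfl, _⟩ := mem_tm.1 h1
    obtain ⟨y, _, _, _, hy, _⟩ := mem_tm.1 h2
    revert hy
    refine Fin.addCases (fun k => ?_) (fun k => ?_) y <;> intro hy
    · rw [jl] at hy
      rw [← hy]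
      fin_cases k <;> simp
    · rw [jr] at hy; exact absurd hy.symm (ne _ _)
  have sg := sum_glue gF gG mF mG hI
  refine ⟨glue (F.image (tm i)) (G.image (tm j)) (i a) (i b) (i c), φ', ?_, ?_, ?_, ?_, ?_⟩
  · exact gF.glue gG mF mG hI
  · intro v
    refine Fin.addCases (fun k => ?_) (fun k => ?_) v
    · obtain ⟨p, q, h⟩ := hF.cov k
      exact ⟨_, dart_glue gF gG mF mG (.inl ((mem_tm' iI).2 h))⟩
    · obtain ⟨p, q, h⟩ := hG.cov (Fin.natAdd 3 k)
      rw [← jr]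
      exact ⟨_, dart_glue gF gG mF mG (.inr ((mem_tm' jI).2 h))⟩
  · have h := sg (fun _ => 1)
    have h1 := hF.card
    have h2 := hG.card
    simp only [Finset.sum_const, nsmul_eq_mul, mul_one,
      Finset.card_image_of_injective _ (tm_inj iI),
      Finset.card_image_of_injective _ (tm_inj jI)] at h
    push_cast at h1 h2 ⊢
    linarith
  · intro x hx
    rcases mem_glue.1 hx with h | h
    · obtain ⟨y, hy, rfl⟩ := Finset.mem_image.1 h.1
      rw [ti]; exact hF.simpl _ hy
    · obtain ⟨y, hy, rfl⟩ := Finset.mem_image.1 h.1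
      rw [tj]; exact hG.simpl _ hy
  · intro t ht
    rw [sg (fun x => w t (tm φ' x)), Finset.sum_image fun x _ y _ h => tm_inj iI h,
      Finset.sum_image fun x _ y _ h => tm_inj jI h]
    simp only [ti, tj]
    rw [hF.deg t ht, hG.deg t ht]
    simp only [tm]
    rw [w_swap t (φ' (i a)) (φ' (i b)) (φ' (i c)), w_swap t (φ' (i b)) (φ' (i c)) (φ' (i a)),
      w_swap t (φ' (i c)) (φ' (i a)) (φ' (i b))]
    ring

/-- All rotations of a list of oriented triangles. -/
def rots {n : ℕ} (P : List (Fin n × Fin n × Fin n)) : List (Fin n × Fin n × Fin n) :=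
  P ++ P.map (fun x => (x.2.1, x.2.2, x.1)) ++ P.map (fun x => (x.2.2, x.1, x.2.1))

/-- The torus piece that adds a handle of degree zero. -/
def L7 : List (Fin 7 × Fin 7 × Fin 7) := rots
  [(0, 3, 2), (3, 1, 4), (1, 2, 5), (2, 4, 6), (4, 5, 0), (5, 6, 3),
   (6, 0, 1), (0, 2, 1), (3, 4, 2), (1, 5, 4), (2, 6, 5), (4, 0, 6),
   (5, 3, 0), (6, 1, 3)]

/-- The seven vertex torus as a list. -/
def L1 : List (Fin 7 × Fin 7 × Fin 7) := rots
  [(1, 2, 4), (2, 3, 5), (3, 4, 6), (4, 5, 0), (5, 6, 1), (6, 0, 2),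
   (0, 1, 3), (1, 4, 3), (2, 5, 4), (3, 6, 5), (4, 0, 6), (5, 1, 0),
   (6, 2, 1), (0, 3, 2)]

/-- The twice subdivided torus, which adds a handle of degree one. -/
def L9 : List (Fin 9 × Fin 9 × Fin 9) := rots
  [(3, 4, 5), (1, 5, 7), (5, 6, 8), (6, 7, 3), (7, 8, 4), (8, 3, 1),
   (3, 5, 1), (4, 6, 5), (1, 7, 6), (5, 8, 7), (6, 3, 8), (7, 4, 3),
   (8, 1, 4), (4, 1, 2), (1, 0, 2), (0, 4, 2), (1, 6, 0), (6, 4, 0)]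

lemma torusF_eq : torusF = L1.toFinset := by decide +kernel

/-- A criterion for `Good` with an explicit successor function in the links. -/
theorem good_of_check {n : ℕ} {F : Finset (Fin n × Fin n × Fin n)}
    {f : Fin n → Fin n → Fin n} {p0 N0 : Fin n → Fin n}
    (h1 : ∀ x ∈ F, (x.2.1, x.2.2, x.1) ∈ F)
    (h2 : ∀ x ∈ F, x.1 ≠ x.2.1 ∧ x.2.1 ≠ x.2.2 ∧ x.1 ≠ x.2.2)
    (h3 : ∀ x ∈ F, x.2.2 = f x.1 x.2.1)
    (h4 : ∀ x ∈ F, (x.2.1, x.1, f x.2.1 x.1) ∈ F)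
    (h5 : ∀ x ∈ F, (x.1, x.2.2, x.2.1) ∉ F)
    (h6 : ∀ u v : Fin n, ∃ k, (u, k, f u k) ∈ F ∧ (k, v, f k v) ∈ F)
    (h7 : ∀ v : Fin n, (f v)^[N0 v + 1] (p0 v) = p0 v)
    (h8 : ∀ x ∈ F, ∃ k : Fin n, k ≤ N0 x.1 ∧ (f x.1)^[k] (p0 x.1) = x.2.1)
    (h9 : ∀ v k : Fin n, k ≤ N0 v → (v, (f v)^[k] (p0 v), f v ((f v)^[k] (p0 v))) ∈ F) : Good F := by
  have e : ∀ a b c, (a, b, c) ∈ F → c = f a b := fun a b c h => h3 _ h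
  refine ⟨fun a b c h => h1 _ h, fun a b c h => h2 _ h, ?_, ?_, fun a b c h => h5 _ h, ?_, ?_⟩
  · intro a b c c' h h'
    rw [e _ _ _ h, e _ _ _ h']
  · intro a b c h; exact ⟨_, h4 _ h⟩
  · intro u _ _ v _ _ _ _
    obtain ⟨k, hk, hk'⟩ := h6 u v
    exact (ReflTransGen.single ⟨_, hk⟩).tail ⟨_, hk'⟩
  · intro v p q p' q' h h'
    have hN := h7 v
    have hs := h9 v
    obtain ⟨k, hkN, hk⟩ := h8 _ h
    obtain ⟨l, hlN, hl⟩ := h8 _ h'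
    simp only at hk hl hkN hlN
    rw [Fin.le_def] at hkN hlN
    have up : ∀ s t : ℕ, s ≤ t → t ≤ N0 v + 1 → ReflTransGen (fun x y => (v, x, y) ∈ F)
        ((f v)^[s] (p0 v)) ((f v)^[t] (p0 v)) := by
      intro s t hst
      induction t, hst using Nat.le_induction with
      | base => intro _; exact .refl
      | succ t _ ih =>
        intro ht
        refine (ih (by omega)).tail ?_
        rw [Function.iterate_succ_apply']
        have tn := (N0 v).isLt
        exact hs ⟨t, by omega⟩ (by rw [Fin.le_def]; simp only; omega)
    rw [← hk, ← hl]
    have kz : ReflTransGen (fun x y => (v, x, y) ∈ F) ((f v)^[k] (p0 v)) (p0 v) := by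
      have := up k (N0 v + 1) (by omega) (by omega)
      rwa [hN] at this
    exact kz.trans (up 0 l (by omega) (by omega))

/-- A Boolean criterion for `Inv`. -/
theorem inv_of_check {n : ℕ} (l : List (Fin n × Fin n × Fin n)) (φ : Fin n → Fin 7) (d : ℕ)
    (f : Fin n → Fin n → Fin n) (p0 N0 : Fin n → Fin n)
    (h0 : l.Nodup)
    (hlen : l.length = 6 * n)
    (h1 : (l.all fun x => l.contains (x.2.1, x.2.2, x.1)) = true)
    (h2 : (l.all fun x => x.1 != x.2.1 && (x.2.1 != x.2.2 && x.1 != x.2.2)) = true)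
    (h3 : (l.all fun x => x.2.2 == f x.1 x.2.1) = true)
    (h4 : (l.all fun x => l.contains (x.2.1, x.1, f x.2.1 x.1)) = true)
    (h5 : (l.all fun x => !l.contains (x.1, x.2.2, x.2.1)) = true)
    (h6 : ((List.finRange n).all fun u => (List.finRange n).all fun v =>
      (List.finRange n).any fun k => l.contains (u, k, f u k) && l.contains (k, v, f k v)) = true)
    (h7 : ((List.finRange n).all fun v => (f v)^[N0 v + 1] (p0 v) == p0 v) = true)
    (h8 : (l.all fun x => (List.finRange n).any fun k =>
      k.val.ble (N0 x.1).val && (f x.1)^[k] (p0 x.1) == x.2.1) = true)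
    (h9 : ((List.finRange n).all fun v => (List.finRange n).all fun k =>
      !(k.val.ble (N0 v).val) || l.contains (v, (f v)^[k] (p0 v), f v ((f v)^[k] (p0 v)))) = true)
    (h10 : ((List.finRange n).all fun v => l.contains (v, p0 v, f v (p0 v))) = true)
    (h11 : (l.all fun x => L1.any fun t =>
      (φ x.1 == t.1 || (φ x.1 == t.2.1 || φ x.1 == t.2.2)) &&
      ((φ x.2.1 == t.1 || (φ x.2.1 == t.2.1 || φ x.2.1 == t.2.2)) &&
      (φ x.2.2 == t.1 || (φ x.2.2 == t.2.1 || φ x.2.2 == t.2.2)))) = true)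
    (h12 : (L1.all fun t => (l.countP fun x => tm φ x == t) ==
      (l.countP fun x => tm φ x == (t.1, t.2.2, t.2.1)) + d) = true) :
    Inv n l.toFinset φ 1 d := by
  simp only [List.all_eq_true, List.any_eq_true, List.contains_iff_mem, Bool.and_eq_true,
    Bool.or_eq_true, Bool.not_eq_true', bne_iff_ne, beq_iff_eq, List.mem_finRange, true_and,
    forall_const, Nat.ble_eq, ← Bool.not_eq_true]
    at h1 h2 h3 h4 h5 h6 h7 h8 h9 h10 h11 h12
  have hm : ∀ x, x ∈ l.toFinset ↔ x ∈ l := fun x => List.mem_toFinset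
  refine ⟨good_of_check (f := f) (p0 := p0) (N0 := N0) ?_ ?_ ?_ ?_ ?_ ?_ ?_ ?_ ?_, ?_, ?_, ?_, ?_⟩
  · simpa only [hm] using h1
  · simpa only [hm] using h2
  · simpa only [hm] using h3
  · simpa only [hm] using h4
  · simpa only [hm] using h5
  · simpa only [hm] using h6
  · exact h7
  · simpa only [hm, Fin.le_def] using h8
  · intro v k hk
    rw [hm]
    exact (h9 v k).resolve_left (not_not.2 hk)
  · intro v
    exact ⟨_, _, (hm _).2 (h10 v)⟩
  · rw [List.toFinset_card_of_nodup h0, hlen]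
    push_cast; ring
  · intro x hx
    obtain ⟨t, ht, k1, k2, k3⟩ := h11 x ((hm _).1 hx)
    refine ⟨t, by rw [torusF_eq]; exact List.mem_toFinset.2 ht, ?_⟩
    intro y hy
    simp only [tm, Finset.mem_insert, Finset.mem_singleton] at hy ⊢
    rcases hy with rfl | rfl | rfl <;> assumption
  · intro t ht
    rw [torusF_eq] at ht
    have := h12 t (List.mem_toFinset.1 ht)
    have cnt : ∀ u : Fin 7 × Fin 7 × Fin 7, (l.toFinset.filter fun x => tm φ x = u).card
        = l.countP fun x => tm φ x == u := by
      intro u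
      rw [List.countP_eq_length_filter, ← List.toFinset_card_of_nodup (h0.filter _),
        List.toFinset_filter]
      simp only [beq_iff_eq]
    simp only [w, Finset.sum_sub_distrib, Finset.sum_boole, cnt]
    rw [this]
    push_cast; ring

theorem inv7 : Inv 7 L7.toFinset ![1, 2, 4, 1, 1, 1, 1] 1 (0 : ℕ) := by
  apply inv_of_check (f := ![![0, 6, 1, 2, 5, 3, 4],
      ![2, 0, 5, 6, 3, 4, 0],
      ![3, 0, 0, 4, 6, 1, 5],
      ![5, 4, 0, 0, 2, 6, 1],
      ![6, 5, 3, 1, 0, 0, 2],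
      ![4, 2, 6, 0, 1, 0, 3],
      ![1, 3, 4, 5, 0, 2, 0]])
      (p0 := ![3, 2, 4, 1, 5, 6, 0])
      (N0 := ![5, 5, 5, 5, 5, 5, 5]) <;> decide +kernel

theorem inv9 : Inv 9 L9.toFinset ![1, 2, 4, 0, 1, 3, 4, 5, 6] 1 (1 : ℕ) := by
  apply inv_of_check (f := ![![0, 6, 1, 0, 2, 0, 4, 0, 0],
      ![2, 0, 4, 5, 8, 7, 0, 6, 3],
      ![4, 0, 0, 0, 1, 0, 0, 0, 0],
      ![0, 8, 0, 0, 5, 1, 7, 4, 6],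
      ![6, 2, 0, 7, 0, 3, 5, 8, 1],
      ![0, 3, 0, 4, 6, 0, 8, 1, 7],
      ![1, 7, 0, 8, 0, 4, 0, 3, 5],
      ![0, 5, 0, 6, 3, 8, 1, 0, 4],
      ![0, 4, 0, 1, 7, 6, 3, 5, 0]])
      (p0 := ![4, 5, 4, 4, 6, 6, 7, 8, 3])
      (N0 := ![3, 7, 2, 5, 7, 5, 6, 5, 5]) <;> decide +kernel

theorem inv1 : Inv 7 L1.toFinset id 1 (1 : ℕ) := by
  apply inv_of_check (f := ![![0, 3, 6, 2, 5, 1, 4],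
      ![5, 0, 4, 0, 3, 6, 2],
      ![3, 6, 0, 5, 1, 4, 0],
      ![1, 4, 0, 0, 6, 2, 5],
      ![6, 2, 5, 1, 0, 0, 3],
      ![4, 0, 3, 6, 2, 0, 1],
      ![2, 5, 1, 4, 0, 3, 0]])
      (p0 := ![1, 2, 3, 4, 5, 6, 0])
      (N0 := ![5, 5, 5, 5, 5, 5, 5]) <;> decide +kernel

/-- Sums of `d` tori, starting from the seven vertex torus. -/
theorem exists_d (d : ℕ) : ∃ F φ, Inv (7 + 6 * d) F φ (1 + d) (1 + d) := by
  induction d with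
  | zero => exact ⟨L1.toFinset, id, by simpa using inv1⟩
  | succ d ih =>
    obtain ⟨F, φ, h⟩ := ih
    obtain ⟨F', φ', h'⟩ := step (m := 6) h inv9 (by positivity) (List.mem_toFinset.2 (by decide +kernel)) rfl rfl rfl
    refine ⟨F', φ', ?_⟩
    push_cast
    rw [← add_assoc]
    rw [Nat.cast_one] at h'
    exact h'

theorem exists_di (d i : ℕ) : ∃ F φ, Inv (7 + 6 * d + 4 * i) F φ (1 + d + i) (1 + d) := by
  induction i with
  | zero =>
    obtain ⟨F, φ, h⟩ := exists_d d
    exact ⟨F, φ, by simpa using h⟩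
  | succ i ih =>
    obtain ⟨F, φ, h⟩ := ih
    obtain ⟨F', φ', h'⟩ := step (m := 4) h inv7 (by positivity) (List.mem_toFinset.2 (by decide +kernel)) rfl rfl rfl
    refine ⟨F', φ', ?_⟩
    push_cast
    rw [← add_assoc]
    rw [Nat.cast_zero, add_zero] at h'
    exact h'

theorem final {n : ℕ} {F : Finset (Fin n × Fin n × Fin n)} {φ : Fin n → Fin 7} {g : ℕ} {d : ℤ}
    (h : Inv n F φ g d) (T : OSurf (Fin 7)) (hT : T.F = torusF) :
    ∃ K : OSurf (Fin n), K.genusIs g ∧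
      ∃ φ : Fin n → Fin 7, IsSimplicialMap K T φ ∧ HasDegree K T φ d := by
  refine ⟨h.good.toSurf h.cov, ?_, φ, ?_, ?_⟩
  · have h1 := Good.faces_card (h.good.toSurf h.cov) h.good
    have h2 := Good.edges_card (h.good.toSurf h.cov) h.good
    have h3 : (((h.good.toSurf h.cov).F.card : ℕ) : ℤ) = _ := h.card
    simp only [OSurf.genusIs, Fintype.card_fin]
    omega
  · intro x hx
    obtain ⟨t, ht, hs⟩ := h.simpl x hx
    exact ⟨_, Finset.mem_image.2 ⟨t, hT ▸ ht, rfl⟩, hs⟩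
  · intro p q r hm
    rw [hT] at hm
    have := h.deg _ hm
    simp only [w, Finset.sum_sub_distrib, Finset.sum_boole] at this
    exact this

end Glue

/-- For `g ≥ 2` and `1 ≤ i ≤ g - 1` there is a triangulation of
the closed orientable genus `g` surface with `6g - 2i + 1` vertices admitting a
simplicial map of degree `g - i` onto the `7`-vertex torus. -/
theorem stmt14 (g i : ℕ) (hg : 2 ≤ g) (hi1 : 1 ≤ i) (hi2 : i ≤ g - 1)
    (T : OSurf (Fin 7)) (hT : T.F = torusF) :
    ∃ K : OSurf (Fin (6 * g - 2 * i + 1)), K.genusIs g ∧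
      ∃ φ : Fin (6 * g - 2 * i + 1) → Fin 7,
        IsSimplicialMap K T φ ∧ HasDegree K T φ ((g : ℤ) - i) := by
  obtain ⟨d, rfl⟩ : ∃ d, g = 1 + d + i := ⟨g - i - 1, by omega⟩
  obtain ⟨F, φ, h⟩ := Glue.exists_di d i
  have e : 6 * (1 + d + i) - 2 * i + 1 = 7 + 6 * d + 4 * i := by omega
  rw [e]
  have e2 : ((1 + d + i : ℕ) : ℤ) - i = 1 + d := by push_cast; ring
  rw [e2]
  exact Glue.final (by push_cast; exact h) T hT
end
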